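/- arXiv:2011.01524 — 9 statements merged into one kernel-verified Lean document; each statement's English description precedes it below -/
import Mathlib

section
/- Let G be a countable monoid, R a ring, and A an Artinian R-module. Let Σ ⊆ A^G be a subshift that is closed in the prodiscrete topology and is an R-submodule of the product module A^G. Let τ_1, …, τ_r : Σ → Σ be pairwise commuting maps, each of which is G-equivariant (τ_i(g ⋆ x) = g ⋆ τ_i(x) for all g ∈ G, x ∈ Σ), R-linear, and uniformly continuous with respect to the prodiscrete uniform structure (for every finite F ⊆ G there is a finite F′ ⊆ G such that for all x, y ∈ Σ, x|_{F′} = y|_{F′} implies τ_i(x)|_F = τ_i(y)|_F). Let Γ be the monoid of maps Σ → Σ generated by τ_1, …, τ_r under composition. Then the valuation action T(τ, x) := τ(x) of Γ on Σ has the shadowing property. -/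
/-- The right shift action: `(g ⋆ x)(h) = x (h * g)`. -/
def shiftMul {G A : Type*} [Mul G] (g : G) (x : G → A) : G → A := fun h => x (h * g)

/-- An exhaustion of a countable monoid: `E 0 = ∅`, increasing, covering `G`,
with each `E n` finite. -/
def IsExhaustion {G : Type*} (E : ℕ → Finset G) : Prop :=
  E 0 = ∅ ∧ (∀ n, E n ⊆ E (n + 1)) ∧ ∀ g : G, ∃ n, g ∈ E n

open Classical in
/-- The standard Hamming metric associated with the exhaustion `E`:
`d(x,y) = 2^{-n}` with `n = sup {k | x = y on E k}`, and `0` if `x = y`. -/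
noncomputable def hamming {G A : Type*} (E : ℕ → Finset G) (x y : G → A) : ℝ :=
  if x = y then 0 else (2 : ℝ)⁻¹ ^ sSup {k : ℕ | ∀ g ∈ E k, x g = y g}

/-- `(S, d, δ)`-pseudo-orbit of the action `T` of `Γ` on `X`. -/
def IsPseudoOrbit {Γ X : Type*} [Monoid Γ] (T : Γ → X → X) (S : Set Γ)
    (d : X → X → ℝ) (δ : ℝ) (o : Γ → X) : Prop :=
  ∀ σ ∈ S, ∀ t : Γ, d (T σ (o t)) (o (σ * t)) < δ

/-- The `(S, d)`-shadowing property of the action `T` of `Γ` on `X`. -/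
def HasShadowing {Γ X : Type*} [Monoid Γ] (T : Γ → X → X) (S : Set Γ)
    (d : X → X → ℝ) : Prop :=
  ∀ ε > (0 : ℝ), ∃ δ > (0 : ℝ), ∀ o : Γ → X, IsPseudoOrbit T S d δ o →
    ∃ x : X, ∀ t : Γ, d (T t x) (o t) < ε

/-- The intrinsic shadowing property for an action of a finitely generated monoid `Γ`
on a subshift `X ⊆ A^G` (given via the inclusion `ι : X → (G → A)`): the
`(S, d|_X)`-shadowing property holds for every finite generating set `S` of `Γ`
and every standard Hamming metric `d` on `A^G`. -/
def HasShadowingProperty {Γ G A X : Type*} [Monoid Γ] [Monoid G]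
    (ι : X → (G → A)) (T : Γ → X → X) : Prop :=
  ∀ S : Set Γ, S.Finite → Submonoid.closure S = ⊤ →
    ∀ E : ℕ → Finset G, IsExhaustion E →
      HasShadowing T S fun x y => hamming E (ι x) (ι y)

/-! ### The descending chain condition for shift-invariant submodules -/

section LeadingCoeffs

variable {M R B : Type*} [LinearOrder M] [Ring R] [AddCommGroup B] [Module R B]

/-- The submodule of leading coefficients at `m` of the elements of `Z` vanishing before `m`. -/
def leadingCoeffs (Z : Submodule R (M → B)) (m : M) : Submodule R B where
  carrier := {b | ∃ z ∈ Z, (∀ k < m, z k = 0) ∧ z m = b}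
  zero_mem' := ⟨0, Z.zero_mem, fun _ _ => rfl, rfl⟩
  add_mem' := by
    rintro _ _ ⟨z, hz, hz0, rfl⟩ ⟨w, hw, hw0, rfl⟩
    exact ⟨z + w, Z.add_mem hz hw, fun k hk => by simp [hz0 k hk, hw0 k hk], rfl⟩
  smul_mem' := by
    rintro c _ ⟨z, hz, hz0, rfl⟩
    exact ⟨c • z, Z.smul_mem c hz, fun k hk => by simp [hz0 k hk], rfl⟩

theorem leadingCoeffs_mono {Z Z' : Submodule R (M → B)} (h : Z ≤ Z') (m : M) :
    leadingCoeffs Z m ≤ leadingCoeffs Z' m := by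
  rintro b ⟨z, hz, hz0, rfl⟩
  exact ⟨z, h hz, hz0, rfl⟩

theorem leadingCoeffs_add_le [AddCommMonoid M] [IsOrderedCancelAddMonoid M] {Z : Submodule R (M → B)}
    (hZ : ∀ z ∈ Z, ∀ e : M, (fun k => z (k + e)) ∈ Z) (m e : M) :
    leadingCoeffs Z (m + e) ≤ leadingCoeffs Z m := by
  rintro b ⟨z, hz, hz0, rfl⟩
  exact ⟨_, hZ z hz e, fun k hk => hz0 _ (add_lt_add_left hk e), rfl⟩

/-- The leading coefficients of a descending chain of shift-invariant submodules stabilize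
uniformly. -/
theorem exists_forall_leadingCoeffs_eq [AddCommMonoid M] [IsOrderedCancelAddMonoid M]
    [IsArtinian R B]
    (hM : ∀ f : ℕ → M, ∃ g : ℕ → ℕ, StrictMono g ∧
      ∀ i j, i ≤ j → ∃ e, f (g j) = f (g i) + e)
    {Z : ℕ → Submodule R (M → B)} (hanti : Antitone Z)
    (hZ : ∀ n, ∀ z ∈ Z n, ∀ e : M, (fun k => z (k + e)) ∈ Z n) :
    ∃ n₀, ∀ n ≥ n₀, ∀ m, leadingCoeffs (Z n) m = leadingCoeffs (Z n₀) m := by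
  by_contra! hcon
  choose next hnext m hm using hcon
  have hlt : ∀ n, leadingCoeffs (Z (next n)) (m n) < leadingCoeffs (Z n) (m n) := fun n =>
    lt_of_le_of_ne (leadingCoeffs_mono (hanti (hnext n)) _) (hm n)
  let a : ℕ → ℕ := fun i => next^[i] 0
  have ha_succ : ∀ i, a (i + 1) = next (a i) := fun i => Function.iterate_succ_apply' next i 0
  have ha : Monotone a := monotone_nat_of_le_succ fun i => (hnext (a i)).trans_eq (ha_succ i).symm
  obtain ⟨g, hg, hge⟩ := hM fun i => m (a i)
  have hstrict : StrictAnti fun i => leadingCoeffs (Z (a (g i))) (m (a (g i))) := by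
    refine strictAnti_nat_of_succ_lt fun i => ?_
    obtain ⟨e, he⟩ := hge i (i + 1) (Nat.le_succ i)
    calc leadingCoeffs (Z (a (g (i + 1)))) (m (a (g (i + 1))))
        ≤ leadingCoeffs (Z (a (g (i + 1)))) (m (a (g i))) := by
          simp only [he]
          exact leadingCoeffs_add_le (hZ _) _ _
      _ ≤ leadingCoeffs (Z (next (a (g i)))) (m (a (g i))) := by
          rw [← ha_succ]
          exact leadingCoeffs_mono (hanti (ha (hg (Nat.lt_succ_self i)))) _
      _ < leadingCoeffs (Z (a (g i))) (m (a (g i))) := hlt _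
  obtain ⟨n, hn⟩ := IsArtinian.monotone_stabilizes
    (⟨fun i => OrderDual.toDual (leadingCoeffs (Z (a (g i))) (m (a (g i)))),
      hstrict.antitone⟩ : ℕ →o (Submodule R B)ᵒᵈ)
  exact (hstrict (Nat.lt_succ_self n)).ne' (hn (n + 1) (Nat.le_succ n))

/-- If a submodule has the same leading coefficients as a larger one, it has the same
restrictions to finite lower sets. -/
theorem exists_mem_eqOn_of_leadingCoeffs_eq {Z Z' : Submodule R (M → B)} (hle : Z ≤ Z')
    (hlead : ∀ m, leadingCoeffs Z m = leadingCoeffs Z' m) {y : M → B} (hy : y ∈ Z')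
    (D : Finset M) (hD : IsLowerSet (D : Set M)) : ∃ z ∈ Z, ∀ k ∈ D, z k = y k := by
  induction D using Finset.induction_on_max with
  | empty => exact ⟨0, Z.zero_mem, by simp⟩
  | insert a s hs ih =>
    have hbelow : ∀ k < a, k ∈ s := fun k hk => by
      have := hD hk.le (by simp)
      simp only [Finset.coe_insert, Set.mem_insert_iff, Finset.mem_coe] at this
      exact this.resolve_left hk.ne
    obtain ⟨z, hz, hzy⟩ := ih fun x k hkx hx => hbelow k (hkx.trans_lt (hs x hx))
    have hmem : (y - z) a ∈ leadingCoeffs Z a := by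
      rw [hlead]
      exact ⟨y - z, Z'.sub_mem hy (hle hz), fun k hk => by simp [hzy k (hbelow k hk)], rfl⟩
    obtain ⟨w, hw, hw0, hwa⟩ := hmem
    refine ⟨z + w, Z.add_mem hz hw, fun k hk => ?_⟩
    rcases Finset.mem_insert.1 hk with rfl | hk
    · simp [hwa]
    · simp [hzy k hk, hw0 k (hs k hk)]

end LeadingCoeffs

/-! ### Linear compactness of closed submodules of `G → A` -/

section LinearCompactness

variable {G R A M B : Type*} [Ring R] [AddCommGroup A] [Module R A]
  [AddCommGroup B] [Module R B]

/-- An increasing sequence of solvable finite systems of linear equations, each depending on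
finitely many coordinates, is solvable in a closed submodule of `G → A`. -/
theorem exists_forall_apply_eq [IsArtinian R A] [TopologicalSpace A] [DiscreteTopology A]
    {V : Submodule R (G → A)} (hV : IsClosed (V : Set (G → A)))
    {E : ℕ → Finset G} (hE : Monotone E) (hEG : ∀ g, ∃ n, g ∈ E n)
    {W : ℕ → Finset M} (hW : Monotone W) (hWM : ∀ k, ∃ n, k ∈ W n)
    (f : M → V →ₗ[R] B)
    (hf : ∀ k, ∃ F : Finset G, ∀ x y : V, (∀ g ∈ F, x.1 g = y.1 g) → f k x = f k y)
    (y : M → B) (hy : ∀ N, ∃ x : V, ∀ k ∈ W N, f k x = y k) :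
    ∃ x : V, ∀ k, f k x = y k := by
  have hstab : ∀ n, ∃ N₀, ∀ N ≥ N₀, ∀ x : V, (∀ k ∈ W N₀, f k x = y k) →
      ∃ x' : V, (∀ k ∈ W N, f k x' = y k) ∧ ∀ g ∈ E n, x'.1 g = x.1 g := by
    intro n
    let ρ : V →ₗ[R] (E n → A) := (LinearMap.funLeft R A Subtype.val).comp V.subtype
    let K : ℕ → Submodule R V := fun N => ⨅ k ∈ W N, LinearMap.ker (f k)
    have hK : ∀ N x, x ∈ K N ↔ ∀ k ∈ W N, f k x = 0 := fun N x => by simp [K]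
    have hKanti : Antitone K := fun N N' h x hx =>
      (hK N x).2 fun k hk => (hK N' x).1 hx k (hW h hk)
    obtain ⟨N₀, hN₀⟩ := IsArtinian.monotone_stabilizes
      (⟨fun N => OrderDual.toDual ((K N).map ρ), fun N N' h => Submodule.map_mono (hKanti h)⟩ :
        ℕ →o (Submodule R (E n → A))ᵒᵈ)
    refine ⟨N₀, fun N hN x hx => ?_⟩
    obtain ⟨u, hu⟩ := hy N
    have hxu : x - u ∈ K N₀ := (hK _ _).2 fun k hk => by
      rw [map_sub, hx k hk, hu k (hW hN hk), sub_self]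
    have hmem : ρ (x - u) ∈ (K N).map ρ := by
      have h : (K N₀).map ρ = (K N).map ρ := hN₀ N hN
      rw [← h]
      exact Submodule.mem_map_of_mem hxu
    obtain ⟨v, hv, hvρ⟩ := hmem
    refine ⟨u + v, fun k hk => by rw [map_add, hu k hk, (hK N v).1 hv k hk, add_zero], ?_⟩
    intro g hg
    have h : v.1 g = x.1 g - u.1 g := congrFun hvρ ⟨g, hg⟩
    simp [h]
  choose N₀ hN₀ using hstab
  let N : ℕ → ℕ := fun n => n + ∑ i ∈ Finset.range (n + 1), N₀ i
  have hNge : ∀ n, N₀ n ≤ N n := fun n =>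
    (Finset.single_le_sum (fun _ _ => Nat.zero_le _) (Finset.self_mem_range_succ n)).trans
      (Nat.le_add_left _ _)
  have hNmono : ∀ n, N n ≤ N (n + 1) := fun n => by
    simp only [N, Finset.sum_range_succ _ (n + 1)]
    omega
  let P : ℕ → Type _ := fun n => {x : V // ∀ k ∈ W (N n), f k x = y k}
  have hstep : ∀ n (x : P n), ∃ x' : P (n + 1), ∀ g ∈ E n, x'.1.1 g = x.1.1 g := by
    intro n x
    obtain ⟨x', hx', hxx'⟩ := hN₀ n (N (n + 1)) ((hNge n).trans (hNmono n)) x.1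
      fun k hk => x.2 k (hW (hNge n) hk)
    exact ⟨⟨x', hx'⟩, hxx'⟩
  choose next hnext using hstep
  obtain ⟨x₀, hx₀⟩ := hy (N 0)
  let s : ∀ n, P n := fun n => Nat.rec ⟨x₀, hx₀⟩ next n
  have hs : ∀ n n', n ≤ n' → ∀ g ∈ E n, (s n').1.1 g = (s n).1.1 g := by
    intro n n' h
    induction n', h using Nat.le_induction with
    | base => exact fun _ _ => rfl
    | succ n' h ih => exact fun g hg => (hnext n' (s n') g (hE h hg)).trans (ih g hg)
  choose idx hidx using hEG
  let x : G → A := fun g => (s (idx g)).1.1 g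
  have hx : ∀ n, ∀ g ∈ E n, x g = (s n).1.1 g := fun n g hg => by
    rcases le_total n (idx g) with h | h
    · exact hs _ _ h g hg
    · exact (hs _ _ h g (hidx g)).symm
  have hxV : x ∈ V := by
    refine hV.mem_of_tendsto (f := fun n => (s n).1.1) (b := Filter.atTop) ?_
      (Filter.Eventually.of_forall fun n => (s n).1.2)
    refine tendsto_pi_nhds.2 fun g => tendsto_const_nhds.congr' ?_
    filter_upwards [Filter.eventually_ge_atTop (idx g)] with n hn
    exact (hs _ _ hn g (hidx g)).symm
  refine ⟨⟨x, hxV⟩, fun k => ?_⟩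
  obtain ⟨F, hF⟩ := hf k
  obtain ⟨n, hn⟩ := hWM k
  let n' := n + ∑ g ∈ F, idx g
  have hkn : k ∈ W (N n') := hW (by simp only [n', N]; omega) hn
  rw [← (s n').2 k hkn]
  refine hF _ _ fun g hg => hx n' g (hE ?_ (hidx g))
  exact (Finset.single_le_sum (fun _ _ => Nat.zero_le _) hg).trans (Nat.le_add_left _ _)

/-- The itineraries `k ↦ f k x` of the points `x` of a closed submodule of `G → A` form a subshift
of finite type. -/
theorem exists_window_forall_apply_eq [IsArtinian R A] [TopologicalSpace A] [DiscreteTopology A]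
    [IsArtinian R B] [AddCommMonoid M] [LinearOrder M] [IsOrderedCancelAddMonoid M]
    (hM : ∀ f : ℕ → M, ∃ g : ℕ → ℕ, StrictMono g ∧
      ∀ i j, i ≤ j → ∃ e, f (g j) = f (g i) + e)
    {V : Submodule R (G → A)} (hV : IsClosed (V : Set (G → A)))
    {E : ℕ → Finset G} (hE : Monotone E) (hEG : ∀ g, ∃ n, g ∈ E n)
    {W : ℕ → Finset M} (hW : Monotone W) (hWM : ∀ k, ∃ n, k ∈ W n)
    (hWlower : ∀ n, IsLowerSet (W n : Set M))
    (f : M → V →ₗ[R] B)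
    (hf : ∀ k, ∃ F : Finset G, ∀ x y : V, (∀ g ∈ F, x.1 g = y.1 g) → f k x = f k y) :
    ∃ D : Finset M, ∀ y : M → B, (∀ t, ∃ x : V, ∀ k ∈ D, f k x = y (k + t)) →
      ∃ x : V, ∀ k, f k x = y k := by
  let Z : ℕ → Submodule R (M → B) := fun n =>
    { carrier := {y | ∀ t, ∃ x : V, ∀ k ∈ W n, f k x = y (k + t)}
      zero_mem' := fun t => ⟨0, fun k _ => by simp⟩
      add_mem' := fun {y z} hy hz t => by
        obtain ⟨x, hx⟩ := hy t
        obtain ⟨x', hx'⟩ := hz t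
        exact ⟨x + x', fun k hk => by simp [hx k hk, hx' k hk]⟩
      smul_mem' := fun c y hy t => by
        obtain ⟨x, hx⟩ := hy t
        exact ⟨c • x, fun k hk => by simp [hx k hk]⟩ }
  have hZanti : Antitone Z := fun n n' h y hy t => by
    obtain ⟨x, hx⟩ := hy t
    exact ⟨x, fun k hk => hx k (hW h hk)⟩
  have hZshift : ∀ n, ∀ z ∈ Z n, ∀ e : M, (fun k => z (k + e)) ∈ Z n := fun n z hz e t => by
    obtain ⟨x, hx⟩ := hz (t + e)
    exact ⟨x, fun k hk => (hx k hk).trans (congrArg z (add_assoc k t e).symm)⟩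
  obtain ⟨n₀, hn₀⟩ := exists_forall_leadingCoeffs_eq hM hZanti hZshift
  refine ⟨W n₀, fun y hy => exists_forall_apply_eq hV hE hEG hW hWM f hf y fun N => ?_⟩
  obtain ⟨z, hz, hzy⟩ := exists_mem_eqOn_of_leadingCoeffs_eq (hZanti (le_max_left n₀ N))
    (hn₀ _ (le_max_left n₀ N)) (y := y) hy (W N) (hWlower N)
  obtain ⟨x, hx⟩ := hz 0
  refine ⟨x, fun k hk => ?_⟩
  rw [hx k (hW (le_max_right n₀ N) hk), add_zero, hzy k hk]

end LinearCompactness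

/-! ### The Hamming metric -/

section Hamming

variable {G A : Type*} {E : ℕ → Finset G}

theorem IsExhaustion.monotone (hE : IsExhaustion E) : Monotone E :=
  monotone_nat_of_le_succ hE.2.1

theorem IsExhaustion.bddAbove_agree (hE : IsExhaustion E) {x y : G → A} (hxy : x ≠ y) :
    BddAbove {k : ℕ | ∀ g ∈ E k, x g = y g} := by
  obtain ⟨g, hg⟩ := Function.ne_iff.1 hxy
  obtain ⟨n, hn⟩ := hE.2.2 g
  exact ⟨n, fun k hk => le_of_not_gt fun h => hg (hk g (hE.monotone h.le hn))⟩

theorem IsExhaustion.eq_of_hamming_lt (hE : IsExhaustion E) {x y : G → A} {n : ℕ}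
    (h : hamming E x y < (2 : ℝ)⁻¹ ^ n) : ∀ g ∈ E n, x g = y g := by
  by_cases hxy : x = y
  · simp [hxy]
  rw [hamming, if_neg hxy] at h
  have hlt : n < sSup {k : ℕ | ∀ g ∈ E k, x g = y g} :=
    (pow_lt_pow_iff_right_of_lt_one₀ (by norm_num) (by norm_num)).1 h
  have hmem : sSup {k : ℕ | ∀ g ∈ E k, x g = y g} ∈ {k : ℕ | ∀ g ∈ E k, x g = y g} :=
    Nat.sSup_mem ⟨0, by simp [hE.1]⟩ (hE.bddAbove_agree hxy)
  exact fun g hg => hmem g (hE.monotone hlt.le hg)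

theorem IsExhaustion.hamming_le (hE : IsExhaustion E) {x y : G → A} {n : ℕ}
    (h : ∀ g ∈ E n, x g = y g) : hamming E x y ≤ (2 : ℝ)⁻¹ ^ n := by
  by_cases hxy : x = y
  · simp [hamming, hxy]
  rw [hamming, if_neg hxy]
  exact pow_le_pow_of_le_one (by norm_num) (by norm_num) (le_csSup (hE.bddAbove_agree hxy) h)

theorem IsExhaustion.exists_subset (hE : IsExhaustion E) (F : Finset G) : ∃ n, F ⊆ E n := by
  choose idx hidx using hE.2.2
  exact ⟨F.sup idx, fun g hg => hE.monotone (Finset.le_sup hg) (hidx g)⟩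

end Hamming

/-! ### Shadowing -/

/-- `T` depends locally on finitely many coordinates. -/
def IsUniformlyLocal {G A : Type*} {X : Set (G → A)} (T : X → X) : Prop :=
  ∀ F : Finset G, ∃ F' : Finset G, ∀ x y : X,
    (∀ g ∈ F', x.1 g = y.1 g) → ∀ g ∈ F, (T x).1 g = (T y).1 g

theorem IsUniformlyLocal.comp {G A : Type*} {X : Set (G → A)} {T T' : X → X}
    (hT : IsUniformlyLocal T) (hT' : IsUniformlyLocal T') : IsUniformlyLocal (T ∘ T') := by
  intro F
  obtain ⟨F₁, h₁⟩ := hT F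
  obtain ⟨F₂, h₂⟩ := hT' F₁
  exact ⟨F₂, fun x y h => h₁ _ _ (h₂ x y h)⟩

open Classical in
/-- A pseudo-orbit with respect to a generating set is one with respect to any single element, with
smaller precision. -/
theorem exists_finset_pseudoOrbit {Γ G A : Type*} [Monoid Γ] {X : Set (G → A)}
    {T : Γ → X → X} (hone : ∀ x, T 1 x = x) (hmul : ∀ a b x, T (a * b) x = T a (T b x))
    (hT : ∀ a, IsUniformlyLocal (T a)) {S : Set Γ} (hS : Submonoid.closure S = ⊤)
    (γ : Γ) : ∀ F : Finset G, ∃ F' : Finset G, ∀ o : Γ → X,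
      (∀ σ ∈ S, ∀ t, ∀ g ∈ F', (T σ (o t)).1 g = (o (σ * t)).1 g) →
      ∀ t, ∀ g ∈ F, (T γ (o t)).1 g = (o (γ * t)).1 g := by
  have hγ : γ ∈ Submonoid.closure S := hS ▸ Submonoid.mem_top γ
  induction hγ using Submonoid.closure_induction with
  | mem σ hσ => exact fun F => ⟨F, fun o ho => ho σ hσ⟩
  | one => exact fun F => ⟨∅, fun o _ t g _ => by rw [hone, one_mul]⟩
  | mul a b _ _ iha ihb =>
    intro F
    obtain ⟨F₁, h₁⟩ := iha F
    obtain ⟨F₂, h₂⟩ := hT a F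
    obtain ⟨F₃, h₃⟩ := ihb F₂
    refine ⟨F₁ ∪ F₃, fun o ho t g hg => ?_⟩
    rw [hmul, mul_assoc]
    refine (h₂ _ _ (h₃ o (fun σ hσ t g hg => ho σ hσ t g ?_) t) g hg).trans
      (h₁ o (fun σ hσ t g hg => ho σ hσ t g ?_) (b * t) g hg)
    · exact Finset.mem_union_right _ hg
    · exact Finset.mem_union_left _ hg

theorem exists_strictMono_add_eq {d : ℕ} (f : ℕ → DegLex (Fin d →₀ ℕ)) :
    ∃ g : ℕ → ℕ, StrictMono g ∧ ∀ i j, i ≤ j → ∃ e, f (g j) = f (g i) + e := by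
  obtain ⟨g, hg⟩ := (wellQuasiOrdered_le (α := Fin d →₀ ℕ)).exists_monotone_subseq
    fun i => ofDegLex (f i)
  refine ⟨g, g.strictMono, fun i j hij => ?_⟩
  obtain ⟨e, he⟩ := exists_add_of_le (hg i j hij)
  exact ⟨toDegLex e, he⟩

/-- Commuting linear actions by uniformly local maps of a finitely generated monoid on a closed
submodule of `G → A` have the shadowing property. -/
theorem hasShadowingProperty_of_linear {G R A Γ : Type*} [Monoid G] [Ring R] [AddCommGroup A]
    [Module R A] [IsArtinian R A] [TopologicalSpace A] [DiscreteTopology A] [CommMonoid Γ]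
    {V : Submodule R (G → A)} (hV : IsClosed (V : Set (G → A)))
    (T : Γ → V →ₗ[R] V) (hone : ∀ x, T 1 x = x) (hmul : ∀ a b x, T (a * b) x = T a (T b x))
    (hT : ∀ a, IsUniformlyLocal (X := (V : Set (G → A))) (T a)) :
    HasShadowingProperty (fun x : V => x.1) (fun a x => T a x) := by
  classical
  intro S hSfin hS E hE ε hε
  obtain ⟨n, hn⟩ := exists_pow_lt_of_lt_one hε (by norm_num : (2 : ℝ)⁻¹ < 1)
  obtain ⟨d, s, -, rfl⟩ := hSfin.fin_param
  let φ : Multiplicative (Fin d →₀ ℕ) →* Γ := AddMonoidHom.toMultiplicativeLeft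
    (Finsupp.liftAddHom fun i => (AddMonoidHom.toMultiplicativeLeft.symm (powersHom Γ (s i))))
  have hφ : ∀ γ, ∃ k : Fin d →₀ ℕ, φ (Multiplicative.ofAdd k) = γ := by
    have h : MonoidHom.mrange φ = ⊤ := by
      rw [eq_top_iff, ← hS, Submonoid.closure_le]
      rintro _ ⟨i, rfl⟩
      refine ⟨Multiplicative.ofAdd (Finsupp.single i 1), ?_⟩
      simp [φ]
    intro γ
    obtain ⟨k, hk⟩ := (h ▸ Submonoid.mem_top γ : γ ∈ MonoidHom.mrange φ)
    exact ⟨k.toAdd, hk⟩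
  let ψ : DegLex (Fin d →₀ ℕ) → Γ := fun k => φ (Multiplicative.ofAdd (ofDegLex k))
  have hψ : ∀ k l, ψ (k + l) = ψ k * ψ l := fun k l => map_mul φ _ _
  have hψ0 : ψ 0 = 1 := map_one φ
  let π : V →ₗ[R] (E n → A) := (LinearMap.funLeft R A Subtype.val).comp V.subtype
  let W : ℕ → Finset (DegLex (Fin d →₀ ℕ)) := fun N =>
    (Finsupp.finite_of_degree_le (σ := Fin d) N).toFinset.map toDegLex.toEmbedding
  have hW : ∀ N k, k ∈ W N ↔ (ofDegLex k).degree ≤ N := fun N k => by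
    simp only [W, Finset.mem_map_equiv]
    simp
  obtain ⟨D, hD⟩ := exists_window_forall_apply_eq exists_strictMono_add_eq hV hE.monotone hE.2.2
    (W := W) (fun N N' h k hk => (hW _ _).2 (((hW _ _).1 hk).trans h))
    (fun k => ⟨_, (hW _ k).2 le_rfl⟩)
    (fun N a b hba ha => (hW N b).2
      ((Finsupp.DegLex.monotone_degree hba).trans ((hW N a).1 ha)))
    (fun k => π.comp (T (ψ k)))
    (fun k => by
      obtain ⟨F, hF⟩ := hT (ψ k) (E n)
      exact ⟨F, fun x y h => funext fun g => hF x y h g.1 g.2⟩)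
  choose F hF using fun γ => exists_finset_pseudoOrbit (X := (V : Set (G → A)))
    (T := fun a x => T a x) hone hmul hT hS γ (E n)
  obtain ⟨m, hm⟩ := hE.exists_subset (D.biUnion fun k => F (ψ k))
  refine ⟨(2 : ℝ)⁻¹ ^ m, by positivity, fun o ho => ?_⟩
  obtain ⟨x, hx⟩ := hD (fun k => π (o (ψ k))) fun t => ⟨o (ψ t), fun k hk => by
    rw [hψ]
    refine funext fun g => hF (ψ k) o (fun σ hσ t' g' hg' => ?_) (ψ t) g.1 g.2
    exact hE.eq_of_hamming_lt (ho σ hσ t') g' (hm (Finset.mem_biUnion.2 ⟨k, hk, hg'⟩))⟩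
  refine ⟨x, fun γ => (hE.hamming_le (n := n) fun g hg => ?_).trans_lt hn⟩
  obtain ⟨k, rfl⟩ := hφ γ
  exact congrFun (hx (toDegLex k)) ⟨g, hg⟩

theorem statement0 {G : Type*} [Monoid G] [Countable G]
    {R : Type*} [Ring R] {A : Type*} [AddCommGroup A] [Module R A] [IsArtinian R A]
    [TopologicalSpace A] [DiscreteTopology A]
    (Sgm : Submodule R (G → A))
    (hshift : ∀ g : G, ∀ x ∈ Sgm, shiftMul g x ∈ Sgm)
    (hclosed : IsClosed (Sgm : Set (G → A)))
    {r : ℕ} (τ : Fin r → ↥Sgm → ↥Sgm)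
    (hcomm : ∀ i j x, τ i (τ j x) = τ j (τ i x))
    (hequiv : ∀ i (g : G) (x : ↥Sgm),
      (τ i ⟨shiftMul g x.1, hshift g x.1 x.2⟩).1 = shiftMul g (τ i x).1)
    (hadd : ∀ i (x y : ↥Sgm), τ i (x + y) = τ i x + τ i y)
    (hsmul : ∀ i (c : R) (x : ↥Sgm), τ i (c • x) = c • τ i x)
    (hUC : ∀ i (F : Finset G), ∃ F' : Finset G, ∀ x y : ↥Sgm,
      (∀ g ∈ F', x.1 g = y.1 g) → ∀ g ∈ F, (τ i x).1 g = (τ i y).1 g) :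
    HasShadowingProperty (fun x : ↥Sgm => x.1)
      (fun f : ↥(Submonoid.closure (M := Function.End ↥Sgm) (Set.range fun i => τ i)) =>
        fun x : ↥Sgm => f.1 x) := by
  have hmem : ∀ f ∈ Submonoid.closure (M := Function.End ↥Sgm) (Set.range fun i => τ i),
      (∀ x y, f (x + y) = f x + f y) ∧ (∀ (c : R) x, f (c • x) = c • f x) ∧
        IsUniformlyLocal (X := (Sgm : Set (G → A))) f := by
    intro f hf
    induction hf using Submonoid.closure_induction with
    | mem f hf =>
      obtain ⟨i, rfl⟩ := hf
      exact ⟨hadd i, hsmul i, hUC i⟩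
    | one => exact ⟨fun _ _ => rfl, fun _ _ => rfl, fun F => ⟨F, fun _ _ h => h⟩⟩
    | mul f g _ _ hf hg =>
      refine ⟨fun x y => ?_, fun c x => ?_, hf.2.2.comp hg.2.2⟩
      · exact (congrArg f (hg.1 x y)).trans (hf.1 _ _)
      · exact (congrArg f (hg.2.1 c x)).trans (hf.2.1 _ _)
  have hcomm' := Submonoid.isMulCommutative_closure (M := Function.End ↥Sgm)
    (s := Set.range fun i => τ i) (by
      rintro _ ⟨i, rfl⟩ _ ⟨j, rfl⟩
      exact funext (hcomm i j))
  let _ : CommMonoid ↥(Submonoid.closure (M := Function.End ↥Sgm) (Set.range fun i => τ i)) :=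
    { Submonoid.toMonoid _ with mul_comm := hcomm'.is_comm.comm }
  exact hasShadowingProperty_of_linear hclosed
    (Γ := ↥(Submonoid.closure (M := Function.End ↥Sgm) (Set.range fun i => τ i)))
    (fun f => ⟨⟨f.1, (hmem f.1 f.2).1⟩, (hmem f.1 f.2).2.1⟩)
    (fun _ => rfl) (fun _ _ _ => rfl) fun f => (hmem f.1 f.2).2.2
end

section
/- Let G be a countable monoid and let A be an Artinian group (every descending sequence of subgroups of A eventually stabilizes). Let Σ ⊆ A^G be a subshift that is closed in the prodiscrete topology and is a subgroup of the product group A^G. Let τ_1, …, τ_r : Σ → Σ be pairwise commuting maps, each of which is G-equivariant (τ_i(g ⋆ x) = g ⋆ τ_i(x) for all g ∈ G, x ∈ Σ), a group homomorphism, and uniformly continuous with respect to the prodiscrete uniform structure (for every finite F ⊆ G there is a finite F′ ⊆ G such that for all x, y ∈ Σ, x|_{F′} = y|_{F′} implies τ_i(x)|_F = τ_i(y)|_F). Let Γ be the monoid of maps Σ → Σ generated by τ_1, …, τ_r under composition. Then the valuation action T(τ, x) := τ(x) of Γ on Σ has the shadowing property. -/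
/-- A set of functions is closed for the topology of pointwise agreement on finite sets. -/
def FinClosed {I A : Type*} (C : Set (I → A)) : Prop :=
  ∀ x : I → A, (∀ K : Finset I, ∃ y ∈ C, ∀ i ∈ K, y i = x i) → x ∈ C

theorem IsClosed.finClosed {I A : Type*} [TopologicalSpace A] [DiscreteTopology A]
    {C : Set (I → A)} (hC : IsClosed C) : FinClosed C := by
  intro x hx
  rw [← hC.closure_eq, mem_closure_iff]
  intro o ho hxo
  obtain ⟨K, u, hu, hsub⟩ := isOpen_pi_iff.1 ho x hxo
  obtain ⟨y, hyC, hy⟩ := hx K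
  exact ⟨y, hsub fun i hi => hy i hi ▸ (hu i hi).2, hyC⟩

theorem wellFoundedLT_of_descending_chain {α : Type*} [PartialOrder α]
    (h : ∀ H : ℕ → α, (∀ n, H (n + 1) ≤ H n) → ∃ N, ∀ n ≥ N, H n = H N) :
    WellFoundedLT α := by
  rw [WellFoundedLT, isWellFounded_iff, RelEmbedding.wellFounded_iff_isEmpty]
  refine ⟨fun a => ?_⟩
  have ha : ∀ n, a (n + 1) < a n := fun n => a.map_rel_iff.2 n.lt_succ_self
  obtain ⟨N, hN⟩ := h a fun n => (ha n).le
  exact (ha N).ne (hN (N + 1) N.le_succ)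

section LeadingGroups

variable {ι L B : Type*} [LinearOrder L] [Group B]

/-- The group of values at `i` of the elements of `X` that are trivial below `i`,
where indices are compared through `f`. -/
def leadGroup (f : ι → L) (X : Subgroup (ι → B)) (i : ι) : Subgroup B where
  carrier := {b | ∃ x ∈ X, (∀ k, f k < f i → x k = 1) ∧ x i = b}
  mul_mem' := by
    rintro _ _ ⟨x, hx, hx1, rfl⟩ ⟨y, hy, hy1, rfl⟩
    exact ⟨x * y, X.mul_mem hx hy, fun k hk => by simp [hx1 k hk, hy1 k hk], rfl⟩
  one_mem' := ⟨1, X.one_mem, fun _ _ => rfl, rfl⟩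
  inv_mem' := by
    rintro _ ⟨x, hx, hx1, rfl⟩
    exact ⟨x⁻¹, X.inv_mem hx, fun k hk => by simp [hx1 k hk], rfl⟩

theorem leadGroup_mono (f : ι → L) (i : ι) :
    Monotone fun X : Subgroup (ι → B) => leadGroup f X i := by
  rintro X Y h _ ⟨x, hx, hx1, rfl⟩
  exact ⟨x, h hx, hx1, rfl⟩

theorem exists_eq_on_of_leadGroup_le {f : ι → L} (hf : Function.Injective f)
    (hfin : ∀ i, {k | f k ≤ f i}.Finite) {X Y : Subgroup (ι → B)} (hXY : X ≤ Y)
    (hlead : ∀ i, leadGroup f Y i ≤ leadGroup f X i) {y : ι → B} (hy : y ∈ Y) (K : Finset ι) :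
    ∃ x ∈ X, ∀ i ∈ K, x i = y i := by
  classical
  have key : ∀ T : Finset ι, (∀ k ∈ T, ∀ j, f j < f k → j ∈ T) →
      ∃ x ∈ X, ∀ i ∈ T, x i = y i := by
    intro T
    induction T using Finset.induction_on_max_value f with
    | empty => exact fun _ => ⟨1, X.one_mem, by simp⟩
    | insert a s ha hmax ih =>
      intro hlow
      obtain ⟨x, hx, hxy⟩ := ih fun k hk j hj =>
        Finset.mem_of_mem_insert_of_ne (hlow k (Finset.mem_insert_of_mem hk) j hj) <| by
          rintro rfl
          exact (hmax k hk).not_gt hj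
      have hbelow : ∀ j, f j < f a → j ∈ s := fun j hj =>
        Finset.mem_of_mem_insert_of_ne (hlow a (Finset.mem_insert_self a s) j hj) <| by
          rintro rfl
          exact lt_irrefl _ hj
      obtain ⟨z, hz, hz1, hza⟩ := hlead a ⟨x⁻¹ * y, Y.mul_mem (Y.inv_mem (hXY hx)) hy,
        fun k hk => by simp [hxy k (hbelow k hk)], rfl⟩
      refine ⟨x * z, X.mul_mem hx hz, fun i hi => ?_⟩
      rcases Finset.mem_insert.1 hi with rfl | his
      · simp [hza]
      · have hlt : f i < f a := (hmax i his).lt_of_ne fun h => ha (hf h ▸ his)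
        simp [hz1 i hlt, hxy i his]
  have hT : (⋃ i ∈ K, {k | f k ≤ f i}).Finite := K.finite_toSet.biUnion fun i _ => hfin i
  obtain ⟨x, hx, hxy⟩ := key hT.toFinset <| by
    intro k hk j hj
    simp only [Set.Finite.mem_toFinset, Set.mem_iUnion, Set.mem_ofPred_eq] at hk ⊢
    obtain ⟨i, hi, hki⟩ := hk
    exact ⟨i, hi, hj.le.trans hki⟩
  refine ⟨x, hx, fun i hi => hxy i ?_⟩
  simp only [Set.Finite.mem_toFinset, Set.mem_iUnion, Set.mem_ofPred_eq]
  exact ⟨i, hi, le_rfl⟩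

end LeadingGroups

theorem wellFoundedLT_subgroup_pi {J A : Type*} [Finite J] [Group A]
    [WellFoundedLT (Subgroup A)] : WellFoundedLT (Subgroup (J → A)) := by
  obtain ⟨n, ⟨e⟩⟩ := Finite.exists_equiv_fin J
  have hmono : StrictMono fun (X : Subgroup (J → A)) (i : J) => leadGroup e X i := by
    intro X Y h
    refine lt_of_le_not_ge (fun i => leadGroup_mono e i h.le) fun hle => h.not_ge fun y hy => ?_
    have := Fintype.ofFinite J
    obtain ⟨x, hx, hxy⟩ := exists_eq_on_of_leadGroup_le e.injective (fun _ => Set.toFinite _)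
      h.le hle hy Finset.univ
    exact funext (fun i => hxy i (Finset.mem_univ i)) ▸ hx
  exact hmono.wellFoundedLT

theorem exists_eventually_eq_of_antitone {P Q : Type*} [Preorder P] [WellQuasiOrderedLE P]
    [PartialOrder Q] [WellFoundedLT Q] {l : P → ℕ → Q} (hP : ∀ n, Antitone fun p => l p n)
    (hN : ∀ p, Antitone (l p)) : ∃ N, ∀ n ≥ N, ∀ p, l p n = l p N := by
  by_contra! h
  choose u hu p hp using h
  let a : ℕ → ℕ := fun j => u^[j] 0
  have ha : ∀ j, a (j + 1) = u (a j) := fun j => Function.iterate_succ_apply' u j 0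
  have hamono : Monotone a := monotone_nat_of_le_succ fun j => (ha j).symm ▸ hu (a j)
  obtain ⟨g, hg⟩ := (wellQuasiOrdered_le (α := P)).exists_monotone_subseq fun j => p (a j)
  refine not_strictAnti_of_wellFoundedLT (fun j => l (p (a (g j))) (a (g j)))
    (strictAnti_nat_of_succ_lt fun j => ?_)
  have h1 : l (p (a (g j))) (a (g j + 1)) < l (p (a (g j))) (a (g j)) := by
    rw [ha]
    exact lt_of_le_of_ne (hN _ (hu _)) (hp _)
  refine lt_of_le_of_lt ?_ h1
  exact (hP _ (hg j (j + 1) j.le_succ)).trans (hN _ (hamono (g.strictMono j.lt_succ_self)))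

/-- Descending chain condition for closed shift-invariant subgroups of `B ^ (ℕ ^ s)`. -/
theorem exists_eventually_eq_of_finClosed {s : ℕ} {B : Type*} [Group B]
    [WellFoundedLT (Subgroup B)] {Q : ℕ → Subgroup ((Fin s →₀ ℕ) → B)} (hQ : Antitone Q)
    (hclosed : ∀ n, FinClosed (Q n : Set ((Fin s →₀ ℕ) → B)))
    (hshift : ∀ n e, ∀ x ∈ Q n, (fun m => x (m + e)) ∈ Q n) :
    ∃ N, ∀ n ≥ N, Q n = Q N := by
  have hlead : ∀ n, Antitone fun m => leadGroup toDegLex (Q n) m := by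
    intro n m m' hm
    obtain ⟨e, rfl⟩ := exists_add_of_le hm
    rintro _ ⟨x, hx, hx1, rfl⟩
    refine ⟨_, hshift n e x hx, fun k hk => hx1 _ ?_, rfl⟩
    simpa [toDegLex_add] using hk
  obtain ⟨N, hN⟩ := exists_eventually_eq_of_antitone hlead
    fun m _ _ h => leadGroup_mono toDegLex m (hQ h)
  refine ⟨N, fun n hn => le_antisymm (hQ hn) fun y hy => hclosed n y fun K => ?_⟩
  refine exists_eq_on_of_leadGroup_le toDegLex.injective (fun i => ?_) (hQ hn)
    (fun m => (hN n hn m).ge) hy K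
  exact (Finsupp.finite_of_degree_le i.degree).subset fun k hk => Finsupp.DegLex.monotone_degree hk

/-- Linear compactness: nested closed subgroups with compatible nonempty finite constraints. -/
theorem exists_mem_forall_eq_on {I A : Type*} [Countable I] [Group A]
    [WellFoundedLT (Subgroup A)] {P : ℕ → Subgroup (I → A)} (hP : Antitone P)
    (hclosed : ∀ k, FinClosed (P k : Set (I → A))) {T : ℕ → Set I} (hT : Monotone T)
    (y : I → A) (hy : ∀ k, ∃ o ∈ P k, ∀ i ∈ T k, o i = y i) :
    ∃ o, (∀ k, o ∈ P k) ∧ ∀ k, ∀ i ∈ T k, o i = y i := by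
  classical
  obtain ⟨code, hcode⟩ := Countable.exists_injective_nat I
  let J : ℕ → Finset I := fun n => ((Set.finite_Iio n).preimage hcode.injOn).toFinset
  have hJ : ∀ n i, i ∈ J n ↔ code i < n := fun n i => by simp [J]
  let H : ℕ → Subgroup (I → A) := fun k =>
    { carrier := {x | x ∈ P k ∧ ∀ i ∈ T k, x i = 1}
      mul_mem' := fun {x z} hx hz =>
        ⟨mul_mem hx.1 hz.1, fun i hi => by simp [hx.2 i hi, hz.2 i hi]⟩
      one_mem' := ⟨one_mem _, fun _ _ => rfl⟩
      inv_mem' := fun {x} hx => ⟨inv_mem hx.1, fun i hi => by simp [hx.2 i hi]⟩ }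
  have hH : Antitone H := fun a b hab x hx => ⟨hP hab hx.1, fun i hi => hx.2 i (hT hab hi)⟩
  have hstab : ∀ n, ∃ N, ∀ k ≥ N, ∀ h ∈ H N, ∃ h' ∈ H k, ∀ i ∈ J n, h' i = h i := by
    intro n
    have := wellFoundedLT_subgroup_pi (J := J n) (A := A)
    let ρ : (I → A) →* (J n → A) :=
      { toFun := fun x i => x i, map_one' := rfl, map_mul' := fun _ _ => rfl }
    obtain ⟨N, hN⟩ := WellFoundedLT.antitone_chain_condition
      (f := fun k => (H k).map ρ) (fun a b hab => Subgroup.map_mono (hH hab))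
    refine ⟨N, fun k hk h hh => ?_⟩
    obtain ⟨h', hh', he⟩ : ρ h ∈ (H k).map ρ := hN k hk ▸ ⟨h, hh, rfl⟩
    exact ⟨h', hh', fun i hi => congrFun he ⟨i, hi⟩⟩
  choose N hN using hstab
  let M : ℕ → ℕ := fun n => n + ∑ j ∈ Finset.range (n + 1), N j
  have hNM : ∀ n, N n ≤ M n := fun n =>
    (Finset.single_le_sum (f := N) (fun _ _ => Nat.zero_le _)
      (Finset.mem_range.2 n.lt_succ_self)).trans (Nat.le_add_left _ _)
  have hMstep : ∀ n, M n ≤ M (n + 1) := fun n =>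
    Nat.add_le_add n.le_succ (Finset.sum_le_sum_of_subset (Finset.range_mono (Nat.le_succ _)))
  let C : ℕ → Set (I → A) := fun k => {x | x ∈ P k ∧ ∀ i ∈ T k, x i = y i}
  have hC : Antitone C := fun a b hab x hx => ⟨hP hab hx.1, fun i hi => hx.2 i (hT hab hi)⟩
  choose c hc using hy
  have hcC : ∀ k, c k ∈ C k := hc
  have hstep : ∀ n (x : C (M n)), ∃ x' : C (M (n + 1)), ∀ i ∈ J n, x'.1 i = x.1 i := by
    rintro n ⟨x, hx⟩
    have hcp := hC (hMstep n) (hcC (M (n + 1)))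
    have hh : (c (M (n + 1)))⁻¹ * x ∈ H (M n) :=
      ⟨mul_mem (inv_mem hcp.1) hx.1, fun i hi => by simp [hcp.2 i hi, hx.2 i hi]⟩
    obtain ⟨h', hh', he⟩ := hN n (M (n + 1)) ((hNM n).trans (hMstep n)) _ (hH (hNM n) hh)
    refine ⟨⟨c (M (n + 1)) * h', mul_mem (hcC _).1 hh'.1, fun i hi => ?_⟩, fun i hi => ?_⟩
    · simp [(hcC (M (n + 1))).2 i hi, hh'.2 i hi]
    · simp [he i hi]
  choose next hnext using hstep
  let x : ∀ n, C (M n) := fun n => Nat.rec ⟨c (M 0), hcC _⟩ next n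
  have hx : ∀ n, ∀ i ∈ J n, (x (n + 1)).1 i = (x n).1 i := fun n => hnext n (x n)
  have hxle : ∀ n k, n ≤ k → ∀ i ∈ J n, (x k).1 i = (x n).1 i := by
    intro n k hk i hi
    induction k, hk using Nat.le_induction with
    | base => rfl
    | succ k hk ih =>
      rw [hx k i ((hJ k i).2 (((hJ n i).1 hi).trans_le hk)), ih]
  let o : I → A := fun i => (x (code i + 1)).1 i
  have ho : ∀ n, ∀ i ∈ J n, (x n).1 i = o i := fun n i hi =>
    hxle (code i + 1) n ((hJ n i).1 hi) i ((hJ _ i).2 (Nat.lt_succ_self _))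
  have hxC : ∀ n, (x n).1 ∈ C n := fun n => hC (Nat.le_add_right n _) (x n).2
  refine ⟨o, fun k => hclosed k o fun K => ?_, fun k i hi => ?_⟩
  · let n := max k (K.sup code + 1)
    refine ⟨(x n).1, (hC (le_max_left _ _) (hxC n)).1, fun i hi => ho n i ((hJ n i).2 ?_)⟩
    exact (Nat.lt_succ_of_le (Finset.le_sup hi)).trans_le (le_max_right _ _)
  · let n := max k (code i + 1)
    rw [← ho n i ((hJ n i).2 (le_max_right k (code i + 1)))]
    exact (hC (le_max_left _ _) (hxC n)).2 i hi

section PseudoOrbits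

variable {G A : Type*} [Group A] {X : Subgroup (G → A)} {s : ℕ}

/-- Families indexed by `ℕ ^ s` that are orbits of the endomorphisms `σ` up to errors
outside `E`. -/
def pseudoOrbits (σ : Fin s → X →* X) (E : Set G) : Subgroup ((Fin s →₀ ℕ) → X) where
  carrier := {p | ∀ i m, ∀ g ∈ E, (σ i (p m)).1 g = (p (m + Finsupp.single i 1)).1 g}
  mul_mem' := fun {p q} hp hq i m g hg => by simp [hp i m g hg, hq i m g hg]
  one_mem' := fun i m g _ => by simp
  inv_mem' := fun {p} hp i m g hg => by simp [hp i m g hg]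

/-- Forget that the entries of a family lie in `X`, and uncurry. -/
def uncurryHom (X : Subgroup (G → A)) (s : ℕ) :
    ((Fin s →₀ ℕ) → X) →* ((Fin s →₀ ℕ) × G → A) where
  toFun p z := (p z.1).1 z.2
  map_one' := rfl
  map_mul' _ _ := rfl

theorem finClosed_map_pseudoOrbits (hX : FinClosed (X : Set (G → A))) (σ : Fin s → X →* X)
    (hσ : ∀ i (g : G), ∃ F : Finset G, ∀ x y : X,
      (∀ h ∈ F, x.1 h = y.1 h) → (σ i x).1 g = (σ i y).1 g) (E : Set G) :
    FinClosed ((pseudoOrbits σ E).map (uncurryHom X s) : Set ((Fin s →₀ ℕ) × G → A)) := by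
  classical
  intro x hx
  have hmem : ∀ m, (fun g => x (m, g)) ∈ X := fun m => hX _ fun K => by
    obtain ⟨_, ⟨p, -, rfl⟩, hp⟩ := hx ({m} ×ˢ K)
    exact ⟨(p m).1, (p m).2, fun g hg => hp (m, g) (by simpa using hg)⟩
  refine ⟨fun m => ⟨_, hmem m⟩, fun i m g hg => ?_, rfl⟩
  obtain ⟨F, hF⟩ := hσ i g
  obtain ⟨_, ⟨p, hp, rfl⟩, hpx⟩ := hx ({m} ×ˢ F ∪ {(m + Finsupp.single i 1, g)})
  have h1 := hF ⟨_, hmem m⟩ (p m) fun h hh => (hpx (m, h) (by simp [hh])).symm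
  rw [h1, hp i m g hg]
  exact hpx (m + Finsupp.single i 1, g) (by simp)

/-- Shadowing for families of endomorphisms of a closed subgroup of `A ^ G`. -/
theorem exists_orbit_of_pseudoOrbits [Countable G] [WellFoundedLT (Subgroup A)]
    (hX : FinClosed (X : Set (G → A))) (σ : Fin s → X →* X)
    (hσ : ∀ i (g : G), ∃ F : Finset G, ∀ x y : X,
      (∀ h ∈ F, x.1 h = y.1 h) → (σ i x).1 g = (σ i y).1 g)
    {E : ℕ → Set G} (hE : Monotone E) (hEtop : ∀ g, ∃ n, g ∈ E n) (F : Finset G) :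
    ∃ N, ∀ p ∈ pseudoOrbits σ (E N), ∃ q : (Fin s →₀ ℕ) → X,
      (∀ i m, σ i (q m) = q (m + Finsupp.single i 1)) ∧ ∀ m, ∀ g ∈ F, (q m).1 g = (p m).1 g := by
  classical
  have hP : Antitone fun n => pseudoOrbits σ (E n) :=
    fun a b hab p hp i m g hg => hp i m g (hE hab hg)
  let ρ : ((Fin s →₀ ℕ) → X) →* ((Fin s →₀ ℕ) → F → A) :=
    { toFun := fun p m g => (p m).1 g, map_one' := rfl, map_mul' := fun _ _ => rfl }
  have := wellFoundedLT_subgroup_pi (J := F) (A := A)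
  obtain ⟨code, hcode⟩ := Countable.exists_injective_nat ((Fin s →₀ ℕ) × G)
  obtain ⟨N, hN⟩ := exists_eventually_eq_of_finClosed
    (Q := fun n => (pseudoOrbits σ (E n)).map ρ) (fun a b hab => Subgroup.map_mono (hP hab))
    (fun n x hx => by
      let y : (Fin s →₀ ℕ) × G → A := fun z => if h : z.2 ∈ F then x z.1 ⟨z.2, h⟩ else 1
      obtain ⟨o, ho, hoy⟩ := exists_mem_forall_eq_on
        (P := fun _ => (pseudoOrbits σ (E n)).map (uncurryHom X s)) antitone_const
        (fun _ => finClosed_map_pseudoOrbits hX σ hσ (E n))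
        (T := fun k => {z | code z < k ∧ z.2 ∈ F}) (fun a b hab z hz => ⟨hz.1.trans_le hab, hz.2⟩)
        y (fun k => by
          have hfin : {z | code z < k}.Finite := (Set.finite_Iio k).preimage hcode.injOn
          obtain ⟨_, ⟨p, hp, rfl⟩, hpx⟩ := hx (hfin.toFinset.image Prod.fst)
          refine ⟨_, ⟨p, hp, rfl⟩, fun z hz => ?_⟩
          have h1 := hpx z.1 (Finset.mem_image_of_mem _ (by simpa using hz.1))
          have h2 : y z = x z.1 ⟨z.2, hz.2⟩ := dif_pos hz.2
          exact (congrFun h1 ⟨z.2, hz.2⟩).trans h2.symm)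
      obtain ⟨q, hq, rfl⟩ := ho 0
      refine ⟨q, hq, ?_⟩
      ext m g
      exact (hoy (code (m, g.1) + 1) (m, g.1) ⟨Nat.lt_succ_self _, g.2⟩).trans (dif_pos g.2))
    (fun n e x hx => by
      obtain ⟨p, hp, rfl⟩ := hx
      refine ⟨fun m => p (m + e), fun i m g hg => ?_, rfl⟩
      rw [hp i (m + e) g hg, add_right_comm])
  refine ⟨N, fun p hp => ?_⟩
  obtain ⟨o, ho, hop⟩ := exists_mem_forall_eq_on
    (P := fun k => (pseudoOrbits σ (E k)).map (uncurryHom X s))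
    (fun a b hab => Subgroup.map_mono (hP hab))
    (fun k => finClosed_map_pseudoOrbits hX σ hσ (E k))
    (T := fun _ => {z | z.2 ∈ F}) monotone_const (uncurryHom X s p) (fun k => by
      obtain ⟨p', hp', he⟩ : ρ p ∈ (pseudoOrbits σ (E (max k N))).map ρ :=
        hN _ (le_max_right k N) ▸ ⟨p, hp, rfl⟩
      exact ⟨_, ⟨p', hP (le_max_left k N) hp', rfl⟩,
        fun z hz => congrFun (congrFun he z.1) ⟨z.2, hz⟩⟩)
  obtain ⟨q, -, rfl⟩ := ho 0
  refine ⟨q, fun i m => Subtype.ext (funext fun g => ?_), fun m g hg => hop 0 (m, g) hg⟩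
  obtain ⟨n, hn⟩ := hEtop g
  obtain ⟨q', hq', he⟩ := ho n
  have hqq : q' = q := funext fun m => Subtype.ext (funext fun g => congrFun he (m, g))
  exact hqq ▸ hq' i m g hn

end PseudoOrbits

section Hamming

variable {G A : Type*} {E : ℕ → Finset G} {x y : G → A}

theorem eq_on_of_hamming_lt (hE : Monotone E) {n : ℕ} (h : hamming E x y < (2 : ℝ)⁻¹ ^ n) :
    ∀ g ∈ E n, x g = y g := by
  unfold hamming at h
  split_ifs at h with hxy
  · simp [hxy]
  have hn := (pow_lt_pow_iff_right_of_lt_one₀ (by norm_num) (by norm_num)).1 h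
  obtain ⟨k, hk, hnk⟩ := exists_lt_of_lt_csSup (by
    by_contra hne
    rw [Set.not_nonempty_iff_eq_empty.1 hne] at hn
    simp at hn) hn
  exact fun g hg => hk g (hE hnk.le hg)

theorem hamming_le_of_eq_on (hE : IsExhaustion E) {n : ℕ} (h : ∀ g ∈ E n, x g = y g) :
    hamming E x y ≤ (2 : ℝ)⁻¹ ^ n := by
  unfold hamming
  split_ifs with hxy
  · positivity
  refine pow_le_pow_of_le_one (by norm_num) (by norm_num) (le_csSup ?_ h)
  obtain ⟨g, hg⟩ := Function.ne_iff.1 hxy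
  obtain ⟨k, hk⟩ := hE.2.2 g
  refine ⟨k, fun j hj => ?_⟩
  by_contra! hkj
  exact hg (hj g (monotone_nat_of_le_succ hE.2.1 hkj.le hk))

end Hamming

theorem Finsupp.induction_add_single_one {ι : Type*} {p : (ι →₀ ℕ) → Prop} (h0 : p 0)
    (hadd : ∀ m i, p m → p (m + Finsupp.single i 1)) (m : ι →₀ ℕ) : p m := by
  suffices h : ∀ a m : ι →₀ ℕ, p m → p (m + a) by simpa using h m 0 h0
  intro a
  induction a using Finsupp.induction_linear with
  | zero => simp
  | add a b ha hb => exact fun m hm => by simpa [add_assoc] using hb _ (ha m hm)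
  | single i n =>
    induction n with
    | zero => simp
    | succ n ih =>
      intro m hm
      rw [Finsupp.single_add, ← add_assoc]
      exact hadd _ i (ih m hm)

/-- A commutative monoid generated by `σ 0, …, σ (s - 1)` is a quotient of `ℕ ^ s`. -/
theorem exists_monomial_surjective {Γ : Type*} [Monoid Γ] (hcomm : ∀ a b : Γ, a * b = b * a)
    {s : ℕ} (σ : Fin s → Γ) (hσ : Submonoid.closure (Set.range σ) = ⊤) :
    ∃ π : (Fin s →₀ ℕ) → Γ, π 0 = 1 ∧ (∀ i m, π (m + Finsupp.single i 1) = σ i * π m) ∧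
      Function.Surjective π := by
  let _ : CommMonoid Γ := { mul_comm := hcomm }
  let π : Multiplicative (Fin s →₀ ℕ) →* Γ :=
    { toFun := fun m => (Multiplicative.toAdd m).prod fun i n => σ i ^ n
      map_one' := Finsupp.prod_zero_index
      map_mul' := fun a b => Finsupp.prod_add_index' (fun i => pow_zero _) fun i => pow_add _ }
  have hsingle : ∀ i, π (Multiplicative.ofAdd (Finsupp.single i 1)) = σ i := fun i =>
    (Finsupp.prod_single_index (h := fun i n => σ i ^ n) (pow_zero _)).trans (pow_one _)
  refine ⟨fun m => π (Multiplicative.ofAdd m), π.map_one, fun i m => ?_, fun f => ?_⟩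
  · change π (Multiplicative.ofAdd m * Multiplicative.ofAdd (Finsupp.single i 1)) = _
    rw [map_mul, hsingle, hcomm]
  · have hf : f ∈ MonoidHom.mrange π := by
      have : Submonoid.closure (Set.range σ) ≤ MonoidHom.mrange π :=
        Submonoid.closure_le.2 (Set.range_subset_iff.2 fun i => ⟨_, hsingle i⟩)
      exact this (hσ ▸ Submonoid.mem_top f)
    obtain ⟨m, rfl⟩ := hf
    exact ⟨Multiplicative.toAdd m, rfl⟩

/-- The uniformly continuous endomorphisms of a subgroup of `A ^ G`. -/
def uniformEnd {G A : Type*} [Group A] (X : Subgroup (G → A)) : Submonoid (Function.End X) where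
  carrier := {f | (∀ x y, f (x * y) = f x * f y) ∧ ∀ F : Finset G, ∃ F' : Finset G,
    ∀ x y : X, (∀ g ∈ F', x.1 g = y.1 g) → ∀ g ∈ F, (f x).1 g = (f y).1 g}
  mul_mem' := by
    rintro f f' ⟨hf, hfu⟩ ⟨hf', hfu'⟩
    refine ⟨fun x y => ?_, fun F => ?_⟩
    · change f (f' _) = f (f' _) * f (f' _)
      rw [hf', hf]
    · obtain ⟨F₁, h₁⟩ := hfu F
      obtain ⟨F₂, h₂⟩ := hfu' F₁
      exact ⟨F₂, fun x y h => h₁ _ _ (h₂ x y h)⟩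
  one_mem' := ⟨fun _ _ => rfl, fun F => ⟨F, fun _ _ h => h⟩⟩

theorem statement1 {G : Type*} [Monoid G] [Countable G]
    {A : Type*} [Group A]
    (hart : ∀ H : ℕ → Subgroup A, (∀ n, H (n + 1) ≤ H n) → ∃ N, ∀ n ≥ N, H n = H N)
    [TopologicalSpace A] [DiscreteTopology A]
    (Sgm : Subgroup (G → A))
    (hshift : ∀ g : G, ∀ x ∈ Sgm, shiftMul g x ∈ Sgm)
    (hclosed : IsClosed (Sgm : Set (G → A)))
    {r : ℕ} (τ : Fin r → ↥Sgm → ↥Sgm)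
    (hcomm : ∀ i j x, τ i (τ j x) = τ j (τ i x))
    (hequiv : ∀ i (g : G) (x : ↥Sgm),
      (τ i ⟨shiftMul g x.1, hshift g x.1 x.2⟩).1 = shiftMul g (τ i x).1)
    (hhom : ∀ i (x y : ↥Sgm), τ i (x * y) = τ i x * τ i y)
    (hUC : ∀ i (F : Finset G), ∃ F' : Finset G, ∀ x y : ↥Sgm,
      (∀ g ∈ F', x.1 g = y.1 g) → ∀ g ∈ F, (τ i x).1 g = (τ i y).1 g) :
    HasShadowingProperty (fun x : ↥Sgm => x.1)
      (fun f : ↥(Submonoid.closure (M := Function.End ↥Sgm) (Set.range fun i => τ i)) =>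
        fun x : ↥Sgm => f.1 x) := by
  intro S hS hgen E hE ε hε
  have := wellFoundedLT_of_descending_chain hart
  have hEmono : Monotone E := monotone_nat_of_le_succ hE.2.1
  obtain ⟨s, σ, -, rfl⟩ := hS.fin_param
  have hend : Submonoid.closure (M := Function.End Sgm) (Set.range fun i => τ i) ≤
      uniformEnd Sgm :=
    Submonoid.closure_le.2 (Set.range_subset_iff.2 fun i => ⟨hhom i, hUC i⟩)
  have hΓ : ∀ a b : Submonoid.closure (M := Function.End Sgm) (Set.range fun i => τ i),
      a * b = b * a :=
    (Submonoid.isMulCommutative_closure (M := Function.End Sgm) (by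
      rintro _ ⟨i, rfl⟩ _ ⟨j, rfl⟩
      exact funext (hcomm i j))).is_comm.comm
  obtain ⟨π, hπ0, hπadd, hπsurj⟩ := exists_monomial_surjective hΓ σ hgen
  obtain ⟨n, hn⟩ := exists_pow_lt_of_lt_one hε (by norm_num : (2 : ℝ)⁻¹ < 1)
  obtain ⟨N, hN⟩ := exists_orbit_of_pseudoOrbits hclosed.finClosed
    (fun i => MonoidHom.mk' (σ i).1 (hend (σ i).2).1)
    (fun i g => by
      obtain ⟨F, hF⟩ := (hend (σ i).2).2 {g}
      exact ⟨F, fun x y h => hF x y h g (Finset.mem_singleton_self g)⟩)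
    (E := fun n => (E n : Set G)) (fun a b h => Finset.coe_subset.2 (hEmono h)) hE.2.2 (E n)
  refine ⟨(2 : ℝ)⁻¹ ^ N, by positivity, fun o ho => ?_⟩
  obtain ⟨q, hq, hqo⟩ := hN (fun m => o (π m)) fun i m g hg => by
    exact (eq_on_of_hamming_lt hEmono (ho (σ i) ⟨i, rfl⟩ (π m)) g hg).trans
      (congrArg (fun f => (o f).1 g) (hπadd i m).symm)
  have hqπ : ∀ m, (π m).1 (q 0) = q m := fun m => by
    induction m using Finsupp.induction_add_single_one with
    | h0 => rw [hπ0]; rfl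
    | hadd m i ih =>
      rw [hπadd, ← hq, ← ih]
      rfl
  refine ⟨q 0, fun t => ?_⟩
  obtain ⟨m, rfl⟩ := hπsurj t
  refine (hamming_le_of_eq_on hE (n := n) ?_).trans_lt hn
  exact fun g hg => (congrArg (fun x => x.1 g) (hqπ m)).trans (hqo m g hg)
end

section
/- Let G be a countable monoid and let A be a set. Let d be the standard Hamming metric on A^G associated with an admissible exhaustion (E_n)_{n≥0} of G. Let τ : A^G → A^G be a cellular automaton. Then there exists a constant C > 0 such that d(τ(x), τ(y)) ≤ C · d(x, y) for all x, y ∈ A^G; that is, τ is a C-Lipschitz map with respect to d. -/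
/-- An admissible exhaustion of a countable monoid `G`: `E 0 = ∅`, `1 ∈ E 1`,
`E n · E n ⊆ E (n+1)`, and `G = ⋃ E n`. -/
def IsAdmissibleExhaustion {G : Type*} [Monoid G] (E : ℕ → Finset G) : Prop :=
  E 0 = ∅ ∧ (1 : G) ∈ E 1 ∧ (∀ n, ∀ a ∈ E n, ∀ b ∈ E n, a * b ∈ E (n + 1)) ∧
    ∀ g : G, ∃ n, g ∈ E n

namespace IsAdmissibleExhaustion

variable {G A : Type*} [Monoid G] {E : ℕ → Finset G}

theorem one_mem (h : IsAdmissibleExhaustion E) (n : ℕ) : (1 : G) ∈ E (n + 1) := by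
  induction n with
  | zero => exact h.2.1
  | succ n ih => simpa using h.2.2.1 _ 1 ih 1 ih

theorem monotone (h : IsAdmissibleExhaustion E) : Monotone E := by
  refine monotone_nat_of_le_succ fun n => ?_
  cases n with
  | zero => simp [h.1]
  | succ n => exact fun a ha => by simpa using h.2.2.1 _ a ha 1 (h.one_mem n)

theorem exists_subset (h : IsAdmissibleExhaustion E) (M : Finset G) : ∃ n, M ⊆ E n := by
  choose f hf using h.2.2.2
  exact ⟨M.sup f, fun g hg => h.monotone (Finset.le_sup hg) (hf g)⟩

theorem bddAbove_agree (h : IsAdmissibleExhaustion E) {x y : G → A} (hxy : x ≠ y) :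
    BddAbove {k : ℕ | ∀ g ∈ E k, x g = y g} := by
  obtain ⟨g, hg⟩ := Function.ne_iff.mp hxy
  obtain ⟨n, hn⟩ := h.2.2.2 g
  refine ⟨n, fun k hk => ?_⟩
  by_contra! hlt
  exact hg (hk g (h.monotone hlt.le hn))

theorem hamming_le (h : IsAdmissibleExhaustion E) {x y : G → A} {k : ℕ}
    (hk : ∀ g ∈ E k, x g = y g) : hamming E x y ≤ (2 : ℝ)⁻¹ ^ k := by
  unfold hamming
  split_ifs with hxy
  · positivity
  · exact pow_le_pow_of_le_one (by norm_num) (by norm_num)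
      (le_csSup (h.bddAbove_agree hxy) hk)

theorem exists_hamming_eq (h : IsAdmissibleExhaustion E) {x y : G → A} (hxy : x ≠ y) :
    ∃ k, (∀ g ∈ E k, x g = y g) ∧ hamming E x y = (2 : ℝ)⁻¹ ^ k :=
  ⟨_, Nat.sSup_mem ⟨0, by simp [h.1]⟩ (h.bddAbove_agree hxy), by simp [hamming, hxy]⟩

end IsAdmissibleExhaustion

theorem statement5 {G A : Type*} [Monoid G] [Countable G]
    (E : ℕ → Finset G) (hadm : IsAdmissibleExhaustion E)
    (τ : (G → A) → (G → A))
    (hca : ∃ (M : Finset G) (μ : (↥(M : Set G) → A) → A),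
      ∀ (x : G → A) (g : G), τ x g = μ fun m : ↥(M : Set G) => x (↑m * g)) :
    ∃ C > (0 : ℝ), ∀ x y : G → A, hamming E (τ x) (τ y) ≤ C * hamming E x y := by
  obtain ⟨M, μ, hμ⟩ := hca
  obtain ⟨n, hn⟩ := hadm.exists_subset M
  refine ⟨2 ^ (n + 1), by positivity, fun x y => ?_⟩
  by_cases hxy : x = y
  · simp [hamming, hxy]
  obtain ⟨k, hk, hd⟩ := hadm.exists_hamming_eq hxy
  have hτ : ∀ g ∈ E (k - (n + 1)), τ x g = τ y g := by
    intro g hg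
    rcases le_or_gt k (n + 1) with hkn | hkn
    · simp [Nat.sub_eq_zero_of_le hkn, hadm.1] at hg
    · obtain ⟨j, rfl⟩ : ∃ j, k = j + 1 := ⟨k - 1, by omega⟩
      rw [hμ, hμ]
      congr 1
      funext m
      exact hk _ (hadm.2.2.1 j _ (hadm.monotone (by omega) (hn m.2)) g
        (hadm.monotone (by omega) hg))
  calc hamming E (τ x) (τ y) ≤ (2 : ℝ)⁻¹ ^ (k - (n + 1)) := hadm.hamming_le hτ
    _ = 2 ^ (n + 1) * (2 : ℝ)⁻¹ ^ (k - (n + 1) + (n + 1)) := by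
      rw [pow_add (2 : ℝ)⁻¹, mul_left_comm, ← mul_pow]; norm_num
    _ ≤ 2 ^ (n + 1) * (2 : ℝ)⁻¹ ^ k := ?_
    _ = 2 ^ (n + 1) * hamming E x y := by rw [hd]
  gcongr ?_ * ?_
  exact pow_le_pow_of_le_one (by norm_num) (by norm_num) (by omega)
end

section
/- Let G be a countable monoid, R a ring, and let A and B be Artinian R-modules. Let τ : A^G → B^G be a cellular automaton admitting a memory set M ⊆ G whose local defining map μ : A^M → B is R-linear. Let Σ ⊆ A^G be a subshift that is closed in the prodiscrete topology and is an R-submodule of the product module A^G. Then the image τ(Σ) ⊆ B^G is a subshift of B^G, is an R-submodule of the product module B^G, and is closed in the prodiscrete topology of B^G. -/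
open Filter Topology

/-- The images under a linear map with Artinian codomain of a decreasing sequence of cosets
stabilize. -/
theorem exists_forall_exists_map_eq_of_antitone_cosets {R V W : Type*} [Ring R]
    [AddCommGroup V] [Module R V] [AddCommGroup W] [Module R W] [IsArtinian R W]
    (r : V →ₗ[R] W) (K : ℕ → Submodule R V) (hK : Antitone K)
    (X : ℕ → Set V) (hX : Antitone X) (hne : ∀ n, (X n).Nonempty)
    (hsub : ∀ n, ∀ x ∈ X n, ∀ w ∈ X n, x - w ∈ K n)
    (hadd : ∀ n, ∀ u ∈ K n, ∀ w ∈ X n, u + w ∈ X n) :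
    ∃ N, ∀ m, ∀ x ∈ X N, ∃ z ∈ X m, r z = r x := by
  obtain ⟨N, hN⟩ := IsArtinian.monotone_stabilizes
    (⟨fun n => OrderDual.toDual ((K n).map r), fun _ _ h => Submodule.map_mono (hK h)⟩ :
      ℕ →o (Submodule R W)ᵒᵈ)
  refine ⟨N, fun m x hx => ?_⟩
  rcases le_total m N with hm | hm
  · exact ⟨x, hX hm hx, rfl⟩
  obtain ⟨w, hw⟩ := hne m
  have h : (K N).map r = (K m).map r := hN m hm
  have hxw : r (x - w) ∈ (K m).map r :=
    h ▸ Submodule.mem_map_of_mem (hsub N x hx w (hX hm hw))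
  obtain ⟨u, hu, hur⟩ := hxw
  exact ⟨u + w, hadd m u hu w hw, by rw [map_add, hur, map_sub, sub_add_cancel]⟩

/-- A decreasing sequence of sets of functions whose restrictions to each finite piece stabilize
admits a pointwise eventually constant sequence of members. -/
theorem exists_pointwise_eventually_eq {G A : Type*} (f : G → ℕ) (X : ℕ → Set (G → A))
    (hX : Antitone X) (hne : ∀ n, (X n).Nonempty)
    (hstab : ∀ k, ∃ N, ∀ m, ∀ x ∈ X N, ∃ z ∈ X m, ∀ g, f g < k → z g = x g) :
    ∃ (s : ℕ → G → A) (x : G → A), (∀ k, s k ∈ X k) ∧ ∀ g, ∀ᶠ k in atTop, s k g = x g := by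
  choose N hN using hstab
  let N' : ℕ → ℕ := fun k => max (N k) k
  have step : ∀ k, ∀ x : X (N' k), ∃ z : X (N' (k + 1)), ∀ g, f g < k → z.1 g = x.1 g := by
    intro k x
    obtain ⟨z, hz, h⟩ := hN k (N' (k + 1)) x.1 (hX (le_max_left _ _) x.2)
    exact ⟨⟨z, hz⟩, h⟩
  choose next hnext using step
  let s : ∀ k, X (N' k) := fun k =>
    Nat.rec ⟨(hne (N' 0)).some, (hne (N' 0)).some_mem⟩ (fun k x => next k x) k
  refine ⟨fun k => (s k).1, fun g => (s (f g + 1)).1 g,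
    fun k => hX (le_max_right _ _) (s k).2, fun g => ?_⟩
  filter_upwards [eventually_ge_atTop (f g + 1)] with k hk
  induction k, hk using Nat.le_induction with
  | base => rfl
  | succ k hk ih => exact (hnext k (s k) g hk).trans ih

/-- A linear map `T` between modules of functions on a countable set, each coordinate of which
depends on finitely many coordinates, maps closed submodules of functions with values in a
discrete Artinian module to closed sets. -/
theorem isClosed_image_of_finite_dependence {G R A B : Type*} [Countable G] [Ring R]
    [AddCommGroup A] [Module R A] [IsArtinian R A] [TopologicalSpace A] [DiscreteTopology A]
    [AddCommGroup B] [Module R B] [TopologicalSpace B] [DiscreteTopology B]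
    (T : (G → A) →ₗ[R] (G → B))
    (hT : ∀ g, ∃ E : Set G, E.Finite ∧ ∀ x z : G → A, (∀ h ∈ E, x h = z h) → T x g = T z g)
    (S : Submodule R (G → A)) (hS : IsClosed (S : Set (G → A))) :
    IsClosed (T '' (S : Set (G → A))) := by
  refine isClosed_of_closure_subset fun y hy => ?_
  obtain ⟨f, hf⟩ := exists_injective_nat G
  have hfin : ∀ k, {g | f g < k}.Finite := fun k =>
    (Set.finite_Iio k).preimage hf.injOn
  let X : ℕ → Set (G → A) := fun n => {x | x ∈ S ∧ ∀ g, f g < n → T x g = y g}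
  let K : ℕ → Submodule R (G → A) := fun n =>
    { carrier := {x | x ∈ S ∧ ∀ g, f g < n → T x g = 0}
      add_mem' := fun {a b} ha hb => ⟨S.add_mem ha.1 hb.1, fun g hg => by
        simp [ha.2 g hg, hb.2 g hg]⟩
      zero_mem' := ⟨S.zero_mem, fun g _ => by simp⟩
      smul_mem' := fun c x hx => ⟨S.smul_mem c hx.1, fun g hg => by simp [hx.2 g hg]⟩ }
  have hX : Antitone X := fun m n h x hx => ⟨hx.1, fun g hg => hx.2 g (hg.trans_le h)⟩
  have hK : Antitone K := fun m n h x hx => ⟨hx.1, fun g hg => hx.2 g (hg.trans_le h)⟩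
  have hne : ∀ n, (X n).Nonempty := by
    intro n
    have hmem : Set.pi {g | f g < n} (fun g => {y g}) ∈ 𝓝 y :=
      set_pi_mem_nhds (hfin n) fun g _ => by simp [nhds_discrete]
    obtain ⟨_, hz, x, hx, rfl⟩ := mem_closure_iff_nhds.1 hy _ hmem
    exact ⟨x, hx, fun g hg => hz g hg⟩
  obtain ⟨s, x, hs, hsx⟩ := exists_pointwise_eventually_eq f X hX hne fun k => by
    have := (hfin k).to_subtype
    obtain ⟨N, hN⟩ := exists_forall_exists_map_eq_of_antitone_cosets
      (LinearMap.funLeft R A (Subtype.val : {g | f g < k} → G)) K hK X hX hne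
      (fun n x hx w hw => ⟨S.sub_mem hx.1 hw.1, fun g hg => by
        simp [hx.2 g hg, hw.2 g hg]⟩)
      (fun n u hu w hw => ⟨S.add_mem hu.1 hw.1, fun g hg => by
        simp [hu.2 g hg, hw.2 g hg]⟩)
    refine ⟨N, fun m x hx => ?_⟩
    obtain ⟨z, hz, h⟩ := hN m x hx
    exact ⟨z, hz, fun g hg => congrFun h ⟨g, hg⟩⟩
  refine ⟨x, hS.mem_of_tendsto (tendsto_pi_nhds.2 fun g => tendsto_nhds_of_eventually_eq (hsx g))
    (Eventually.of_forall fun k => (hs k).1), funext fun g => ?_⟩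
  obtain ⟨E, hE, hEg⟩ := hT g
  obtain ⟨k, hk, hgk⟩ := (((eventually_all_finite hE).2 fun h _ => hsx h).and
    (eventually_gt_atTop (f g))).exists
  exact (hEg (s k) x hk).symm.trans ((hs k).2 g hgk)


theorem statement9 {G : Type*} [Monoid G] [Countable G]
    {R : Type*} [Ring R]
    {A : Type*} [AddCommGroup A] [Module R A] [IsArtinian R A]
    [TopologicalSpace A] [DiscreteTopology A]
    {B : Type*} [AddCommGroup B] [Module R B] [IsArtinian R B]
    [TopologicalSpace B] [DiscreteTopology B]
    (τ : (G → A) → (G → B))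
    (M : Finset G) (μ : (↥(M : Set G) → A) →ₗ[R] B)
    (hca : ∀ (x : G → A) (g : G), τ x g = μ fun m : ↥(M : Set G) => x (↑m * g))
    (Sgm : Submodule R (G → A))
    (hshift : ∀ g : G, ∀ x ∈ Sgm, shiftMul g x ∈ Sgm)
    (hclosed : IsClosed (Sgm : Set (G → A))) :
    (∀ g : G, ∀ y ∈ τ '' (Sgm : Set (G → A)), shiftMul g y ∈ τ '' (Sgm : Set (G → A))) ∧
    (∃ N : Submodule R (G → B), (N : Set (G → B)) = τ '' (Sgm : Set (G → A))) ∧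
    IsClosed (τ '' (Sgm : Set (G → A))) := by
  let T : (G → A) →ₗ[R] (G → B) := LinearMap.pi fun g =>
    μ ∘ₗ LinearMap.funLeft R A fun m : ↥(M : Set G) => (m : G) * g
  have hτ : τ = T := funext fun x => funext fun g => hca x g
  refine ⟨?_, ⟨Sgm.map T, by rw [hτ, Submodule.map_coe]⟩, ?_⟩
  · rintro g _ ⟨x, hx, rfl⟩
    refine ⟨shiftMul g x, hshift g x hx, funext fun h => ?_⟩
    simp only [shiftMul, hca, mul_assoc]
  · rw [hτ]
    refine isClosed_image_of_finite_dependence T (fun g => ?_) Sgm hclosed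
    refine ⟨(fun m => m * g) '' (M : Set G), M.finite_toSet.image _, fun x z h => ?_⟩
    exact congrArg μ (funext fun m => h _ ⟨m, m.2, rfl⟩)
end

section
/- Let r ∈ ℕ, let F be a finite monoid, and let G := ℕ^r × F (a countable monoid under componentwise operation). Let R be a ring and let A be an Artinian R-module. Let Σ ⊆ A^G be a subshift that is closed in the prodiscrete topology and is an R-submodule of the product module A^G. Then Σ is a subshift of finite type: there exist a finite subset D ⊆ G and a subset P ⊆ A^D such that Σ = Σ(A^G; D, P). -/
/-- `Σ(A^G; D, P) = {x ∈ A^G | (g ⋆ x)|_D ∈ P for all g ∈ G}`. -/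
def SigmaSet {G : Type*} [Mul G] {A : Type*} (D : Set G) (P : Set (↥D → A)) :
    Set (G → A) :=
  {x | ∀ g : G, (fun d : ↥D => shiftMul g x ↑d) ∈ P}

/-- A family of elements of a well-founded order that is antitone in a natural number and in a
well-quasi-ordered parameter stabilizes uniformly in the parameter. -/
theorem exists_forall_eq_of_antitone {ι α : Type*} [Preorder ι] [WellQuasiOrderedLE ι]
    [PartialOrder α] [WellFoundedLT α] (f : ℕ → ι → α) (hf : Antitone f)
    (hf' : ∀ k, Antitone (f k)) : ∃ N, ∀ k ≥ N, ∀ n, f k n = f N n := by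
  by_contra! h
  choose k hk n hn using h
  let a : ℕ → ℕ := fun j => k^[j] 0
  have ha (j : ℕ) : a (j + 1) = k (a j) := Function.iterate_succ_apply' k j 0
  have ha_mono : Monotone a := monotone_nat_of_le_succ fun j => by rw [ha]; exact hk _
  obtain ⟨g, hg⟩ := (wellQuasiOrdered_le (α := ι)).exists_monotone_subseq (fun j => n (a j))
  have hlt (j : ℕ) : f (a (g (j + 1))) (n (a (g (j + 1)))) < f (a (g j)) (n (a (g j))) := by
    have h1 : f (a (g (j + 1))) (n (a (g (j + 1)))) ≤ f (a (g (j + 1))) (n (a (g j))) :=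
      hf' _ (hg _ _ j.le_succ)
    have h2 : f (a (g (j + 1))) (n (a (g j))) ≤ f (a (g j + 1)) (n (a (g j))) :=
      hf (ha_mono (g.strictMono j.lt_succ_self)) _
    have h3 : f (a (g j + 1)) (n (a (g j))) < f (a (g j)) (n (a (g j))) := by
      rw [ha]
      exact lt_of_le_of_ne (hf (hk _) _) (hn _)
    exact (h1.trans h2).trans_lt h3
  exact not_strictAnti_of_wellFoundedLT _ (strictAnti_nat_of_succ_lt (f := fun j => f (a (g j)) (n (a (g j)))) hlt)

/-- The graded lexicographic key of an exponent. -/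
def gradedKey {r : ℕ} (m : Fin r → ℕ) : ℕ ×ₗ Lex (Fin r → ℕ) := toLex (∑ i, m i, toLex m)

theorem gradedKey_injective {r : ℕ} : Function.Injective (gradedKey (r := r)) :=
  fun _ _ h => toLex.injective (congrArg (fun p => (ofLex p).2) h)

theorem gradedKey_add {r : ℕ} (m n : Fin r → ℕ) :
    gradedKey (m + n) = gradedKey m + gradedKey n := by
  simp only [gradedKey, Pi.add_apply, Finset.sum_add_distrib]
  rfl

theorem gradedKey_add_lt_add {r : ℕ} {m n : Fin r → ℕ} (h : gradedKey m < gradedKey n)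
    (k : Fin r → ℕ) : gradedKey (m + k) < gradedKey (n + k) := by
  rw [gradedKey_add, gradedKey_add]
  exact add_lt_add_left h _

theorem sum_le_of_gradedKey_le {r : ℕ} {m n : Fin r → ℕ} (h : gradedKey m ≤ gradedKey n) :
    ∑ i, m i ≤ ∑ i, n i :=
  Prod.Lex.monotone_fst _ _ h

theorem finite_setOf_sum_le (r N : ℕ) : {m : Fin r → ℕ | ∑ i, m i ≤ N}.Finite :=
  (Set.finite_Iic (fun _ => N)).subset fun _ hm i =>
    (Finset.single_le_sum (fun _ _ => Nat.zero_le _) (Finset.mem_univ i)).trans hm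

section

variable {r : ℕ} {F R A : Type*} [Ring R] [AddCommGroup A] [Module R A]

/-- The `R`-module of leading coefficients at the exponent `n`: the values at `n` of the
configurations of `S` that vanish at all smaller exponents. -/
def leadingModule (S : Submodule R (Multiplicative (Fin r → ℕ) × F → A)) (n : Fin r → ℕ) :
    Submodule R (F → A) where
  carrier := {v | ∃ x ∈ S, (∀ m, gradedKey m < gradedKey n → ∀ f, x (.ofAdd m, f) = 0) ∧
    ∀ f, x (.ofAdd n, f) = v f}
  zero_mem' := ⟨0, S.zero_mem, fun _ _ _ => rfl, fun _ => rfl⟩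
  add_mem' := by
    rintro v w ⟨x, hx, hx0, hxv⟩ ⟨y, hy, hy0, hyw⟩
    exact ⟨x + y, S.add_mem hx hy, fun m hm f => by simp [hx0 m hm f, hy0 m hm f],
      fun f => by simp [hxv, hyw]⟩
  smul_mem' := by
    rintro c v ⟨x, hx, hx0, hxv⟩
    exact ⟨c • x, S.smul_mem c hx, fun m hm f => by simp [hx0 m hm f], fun f => by simp [hxv]⟩

theorem leadingModule_mono {S T : Submodule R (Multiplicative (Fin r → ℕ) × F → A)} (h : S ≤ T) :
    leadingModule S ≤ leadingModule T := by
  rintro n v ⟨x, hx, hx'⟩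
  exact ⟨x, h hx, hx'⟩

theorem leadingModule_antitone [Monoid F]
    {S : Submodule R (Multiplicative (Fin r → ℕ) × F → A)}
    (hS : ∀ g, ∀ x ∈ S, shiftMul g x ∈ S) : Antitone (leadingModule S) := by
  intro n n' hn v
  obtain ⟨k, rfl⟩ := exists_add_of_le hn
  rintro ⟨x, hx, hx0, hxv⟩
  refine ⟨shiftMul (.ofAdd k, 1) x, hS _ x hx, fun m hm f => ?_, fun f => ?_⟩
  · simpa [shiftMul, ← ofAdd_add] using hx0 (m + k) (gradedKey_add_lt_add hm k) f
  · simpa [shiftMul, ← ofAdd_add] using hxv f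

/-- If all leading modules of `T` are contained in those of `S ≤ T`, then every element of `T`
agrees with an element of `S` on each set of exponents of bounded degree. -/
theorem exists_mem_eq_of_leadingModule_le
    {S T : Submodule R (Multiplicative (Fin r → ℕ) × F → A)} (hST : S ≤ T)
    (h : leadingModule T ≤ leadingModule S) {x : Multiplicative (Fin r → ℕ) × F → A}
    (hx : x ∈ T) (N : ℕ) :
    ∃ y ∈ S, ∀ m : Fin r → ℕ, ∑ i, m i ≤ N → ∀ f, x (.ofAdd m, f) = y (.ofAdd m, f) := by
  classical
  suffices H : ∀ s : Finset (Fin r → ℕ), (∀ n ∈ s, ∀ m, gradedKey m ≤ gradedKey n → m ∈ s) →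
      ∃ y ∈ S, ∀ m ∈ s, ∀ f, x (.ofAdd m, f) = y (.ofAdd m, f) by
    obtain ⟨y, hy, hxy⟩ := H (finite_setOf_sum_le r N).toFinset (by
      simp only [Set.Finite.mem_toFinset, Set.mem_ofPred_eq]
      exact fun n hn m hm => (sum_le_of_gradedKey_le hm).trans hn)
    exact ⟨y, hy, fun m hm => hxy m (by simpa using hm)⟩
  intro s
  induction s using Finset.induction_on_max_value gradedKey with
  | empty => exact fun _ => ⟨0, S.zero_mem, by simp⟩
  | insert a s ha hmax ih =>
    intro hlow
    have hne {m : Fin r → ℕ} (hm : m ∈ s) : m ≠ a := fun e => ha (e ▸ hm)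
    obtain ⟨y, hy, hxy⟩ := ih fun n hn m hm => by
      refine Finset.mem_of_mem_insert_of_ne (hlow n (Finset.mem_insert_of_mem hn) m hm) ?_
      rintro rfl
      exact hne hn (gradedKey_injective ((hmax n hn).antisymm hm))
    obtain ⟨z, hz, hz0, hza⟩ := h a (show (fun f => (x - y) (.ofAdd a, f)) ∈ leadingModule T a from
      ⟨x - y, T.sub_mem hx (hST hy), fun m hm f => by
        have hm' : m ∈ s := Finset.mem_of_mem_insert_of_ne
          (hlow a (Finset.mem_insert_self a s) m hm.le) (by rintro rfl; exact hm.false)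
        simp [hxy m hm' f], fun _ => rfl⟩)
    refine ⟨y + z, S.add_mem hy hz, fun m hm f => ?_⟩
    rcases Finset.mem_insert.1 hm with rfl | hm
    · simp [hza]
    · have hlt : gradedKey m < gradedKey a :=
        (hmax m hm).lt_of_ne fun e => hne hm (gradedKey_injective e)
      simp [hz0 m hlt f, hxy m hm f]

/-- The submodule of configurations all of whose shifts agree with an element of `S` on `D`. -/
def finiteTypeHull {G : Type*} [Monoid G] (S : Submodule R (G → A)) (D : Set G) :
    Submodule R (G → A) where
  carrier := {x | ∀ g, ∃ y ∈ S, ∀ d ∈ D, shiftMul g x d = y d}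
  zero_mem' := fun _ => ⟨0, S.zero_mem, fun _ _ => rfl⟩
  add_mem' := by
    intro x x' hx hx' g
    obtain ⟨y, hy, h⟩ := hx g
    obtain ⟨y', hy', h'⟩ := hx' g
    exact ⟨y + y', S.add_mem hy hy', fun d hd => congrArg₂ (· + ·) (h d hd) (h' d hd)⟩
  smul_mem' := by
    intro c x hx g
    obtain ⟨y, hy, h⟩ := hx g
    exact ⟨c • y, S.smul_mem c hy, fun d hd => congrArg (c • ·) (h d hd)⟩

theorem shiftMul_mem_finiteTypeHull {G : Type*} [Monoid G] (S : Submodule R (G → A)) (D : Set G)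
    (g : G) (x : G → A) (hx : x ∈ finiteTypeHull S D) : shiftMul g x ∈ finiteTypeHull S D := by
  intro k
  obtain ⟨y, hy, h⟩ := hx (k * g)
  exact ⟨y, hy, fun d hd => by simpa [shiftMul, mul_assoc] using h d hd⟩

theorem finiteTypeHull_antitone {G : Type*} [Monoid G] (S : Submodule R (G → A)) :
    Antitone (finiteTypeHull S) := by
  intro D E hDE x hx g
  obtain ⟨y, hy, h⟩ := hx g
  exact ⟨y, hy, fun d hd => h d (hDE hd)⟩

theorem coe_finiteTypeHull {G : Type*} [Monoid G] (S : Submodule R (G → A)) (D : Set G) :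
    (finiteTypeHull S D : Set (G → A)) = SigmaSet D {p | ∃ y ∈ S, ∀ d, p d = y d} := by
  ext x
  simp [finiteTypeHull, SigmaSet]

end

theorem mem_of_forall_finset_exists_eq {ι A : Type*} [TopologicalSpace A] [DiscreteTopology A]
    {S : Set (ι → A)} (hS : IsClosed S) {x : ι → A}
    (h : ∀ D : Finset ι, ∃ y ∈ S, ∀ d ∈ D, x d = y d) : x ∈ S := by
  rw [← hS.closure_eq, mem_closure_iff]
  intro U hU hxU
  obtain ⟨D, u, hu, hD⟩ := isOpen_pi_iff.1 hU x hxU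
  obtain ⟨y, hy, hxy⟩ := h D
  exact ⟨y, hD fun d hd => hxy d hd ▸ (hu d hd).2, hy⟩

theorem statement10 (r : ℕ) {F : Type*} [Monoid F] [Finite F]
    {R : Type*} [Ring R] {A : Type*} [AddCommGroup A] [Module R A] [IsArtinian R A]
    [TopologicalSpace A] [DiscreteTopology A]
    (Sgm : Submodule R ((Multiplicative (Fin r → ℕ) × F) → A))
    (hshift : ∀ g : Multiplicative (Fin r → ℕ) × F, ∀ x ∈ Sgm, shiftMul g x ∈ Sgm)
    (hclosed : IsClosed (Sgm : Set ((Multiplicative (Fin r → ℕ) × F) → A))) :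
    ∃ (D : Finset (Multiplicative (Fin r → ℕ) × F))
      (P : Set (↥(D : Set (Multiplicative (Fin r → ℕ) × F)) → A)),
      (Sgm : Set ((Multiplicative (Fin r → ℕ) × F) → A)) =
        SigmaSet (D : Set (Multiplicative (Fin r → ℕ) × F)) P := by
  classical
  let B : ℕ → Set (Multiplicative (Fin r → ℕ) × F) := fun N => {g | ∑ i, g.1.toAdd i ≤ N}
  have hB_fin (N : ℕ) : (B N).Finite :=
    (((finite_setOf_sum_le r N).preimage Multiplicative.toAdd.injective.injOn).prod
      Set.finite_univ).subset fun g hg => ⟨hg, Set.mem_univ g.2⟩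
  have hB_mono : Monotone B := fun N N' h g hg => le_trans (α := ℕ) hg h
  have hH_anti : Antitone fun N => finiteTypeHull Sgm (B N) :=
    (finiteTypeHull_antitone Sgm).comp_monotone hB_mono
  obtain ⟨N, hN⟩ := exists_forall_eq_of_antitone
    (fun N => leadingModule (finiteTypeHull Sgm (B N)))
    (fun i j hij => leadingModule_mono (hH_anti hij))
    (fun N => leadingModule_antitone (shiftMul_mem_finiteTypeHull Sgm (B N)))
  refine ⟨(hB_fin N).toFinset, {p | ∃ y ∈ Sgm, ∀ d, p d = y d}, ?_⟩
  rw [← coe_finiteTypeHull, Set.Finite.coe_toFinset]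
  refine Set.Subset.antisymm (fun x hx g => ⟨_, hshift g x hx, fun _ _ => rfl⟩) fun x hx => ?_
  refine mem_of_forall_finset_exists_eq hclosed fun D => ?_
  let j := max N (D.sup fun g => ∑ i, g.1.toAdd i)
  have hDj : ∀ d ∈ D, d ∈ B j := fun d hd =>
    (Finset.le_sup (f := fun g => ∑ i, g.1.toAdd i) hd).trans (le_max_right _ _)
  obtain ⟨y, hy, hxy⟩ := exists_mem_eq_of_leadingModule_le (hH_anti (le_max_left N _ : N ≤ j))
    (fun n => (hN j (le_max_left _ _) n).ge) hx j
  obtain ⟨z, hz, hyz⟩ := hy 1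
  refine ⟨z, hz, fun d hd => ?_⟩
  have h1 : x d = y d := hxy d.1.toAdd (hDj d hd) d.2
  have h2 : y d = z d := by simpa [shiftMul] using hyz d (hDj d hd)
  exact h1.trans h2
end

section
/- Fix a ring R. Let H be a countable monoid of R-Markov type, i.e., for every Artinian R-module B, every subshift of B^H that is closed in the prodiscrete topology and is an R-submodule of the product module B^H is a subshift of finite type of B^H. Then the countable monoid H × ℕ is also of R-Markov type: for every Artinian R-module B, every subshift of B^{H×ℕ} that is closed in the prodiscrete topology and is an R-submodule of B^{H×ℕ} is a subshift of finite type of B^{H×ℕ}. -/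
universe u v w

/-- A monoid `H` is of `R`-Markov type if for every Artinian `R`-module `B`,
every subshift of `B^H` which is closed in the prodiscrete topology and is an
`R`-submodule of `B^H` is a subshift of finite type. -/
def IsRMarkovType (R : Type u) [Ring R] (H : Type v) [Monoid H] : Prop :=
  ∀ (B : Type w) [AddCommGroup B] [Module R B] [IsArtinian R B]
    [TopologicalSpace B] [DiscreteTopology B]
    (Sgm : Submodule R (H → B)),
    (∀ g : H, ∀ x ∈ Sgm, shiftMul g x ∈ Sgm) →
    IsClosed (Sgm : Set (H → B)) →
    ∃ (D : Finset H) (P : Set (↥(D : Set H) → B)),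
      (Sgm : Set (H → B)) = SigmaSet (D : Set H) P

/-- A set of configurations is pattern-closed if it contains every configuration all of whose
finite patterns occur, at the same place, in one of its elements. -/
def PatternClosed {G B : Type*} (S : Set (G → B)) : Prop :=
  ∀ x : G → B, (∀ F : Finset G, ∃ y ∈ S, ∀ g ∈ F, y g = x g) → x ∈ S

lemma isClosed_iff_patternClosed {G B : Type*} [TopologicalSpace B] [DiscreteTopology B]
    (S : Set (G → B)) : IsClosed S ↔ PatternClosed S := by
  rw [← isOpen_compl_iff, isOpen_pi_iff]
  constructor
  · intro h x hx
    by_contra hxS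
    obtain ⟨F, u, hu, hsub⟩ := h x hxS
    obtain ⟨y, hy, hyx⟩ := hx F
    refine hsub (fun g hg => ?_) hy
    rw [hyx g hg]
    exact (hu g hg).2
  · intro h x hx
    by_contra! hcon
    refine hx (h x fun F => ?_)
    have := hcon F (fun g => {x g}) fun g _ => ⟨isOpen_discrete _, rfl⟩
    obtain ⟨y, hy, hyS⟩ := Set.not_subset.1 this
    exact ⟨y, not_not.1 hyS, fun g hg => hy g hg⟩

section Artinian

variable {R : Type*} [Ring R] {B : Type*} [AddCommGroup B] [Module R B] [IsArtinian R B]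
  {G : Type*}

lemma exists_forall_eqOn_of_antitone {S : ℕ → Submodule R (G → B)} (hS : Antitone S)
    (F : Finset G) :
    ∃ m, ∀ n, m ≤ n → ∀ x ∈ S m, ∃ y ∈ S n, ∀ g ∈ F, y g = x g := by
  let res : (G → B) →ₗ[R] (F → B) := LinearMap.funLeft R B Subtype.val
  let f : ℕ →o (Submodule R (F → B))ᵒᵈ :=
    ⟨fun n => OrderDual.toDual ((S n).map res), fun a b hab => Submodule.map_mono (hS hab)⟩
  obtain ⟨m, hm⟩ := IsArtinian.monotone_stabilizes f
  refine ⟨m, fun n hn x hx => ?_⟩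
  have hx' : res x ∈ (S n).map res := by
    have h : (S m).map res = (S n).map res := hm n hn
    exact h ▸ Submodule.mem_map_of_mem hx
  obtain ⟨y, hy, hyx⟩ := hx'
  exact ⟨y, hy, fun g hg => congrFun hyx ⟨g, hg⟩⟩

/-- Linear compactness for decreasing sequences of cosets in `B ^ G`. -/
lemma nonempty_iInter_of_cosets [Countable G] {C : ℕ → Set (G → B)} (hC : Antitone C)
    (hcl : ∀ n, PatternClosed (C n)) (hne : ∀ n, (C n).Nonempty)
    {T : ℕ → Submodule R (G → B)} (hT : ∀ n, ∀ c ∈ C n, ∀ x, x ∈ C n ↔ x - c ∈ T n) :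
    (⋂ n, C n).Nonempty := by
  classical
  have hTanti : Antitone T := by
    intro a b hab t ht
    obtain ⟨c, hc⟩ := hne b
    have h : c + t ∈ C b := (hT b c hc _).2 (by simpa using ht)
    simpa using (hT a c (hC hab hc) _).1 (hC hab h)
  have hstab : ∀ F : Finset G, ∃ m, ∀ n, m ≤ n → ∀ x ∈ C m, ∃ y ∈ C n, ∀ g ∈ F, y g = x g := by
    intro F
    obtain ⟨m, hm⟩ := exists_forall_eqOn_of_antitone hTanti F
    refine ⟨m, fun n hn x hx => ?_⟩
    obtain ⟨c, hc⟩ := hne n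
    obtain ⟨t, ht, htx⟩ := hm n hn (x - c) ((hT m c (hC hn hc) x).1 hx)
    refine ⟨c + t, (hT n c hc _).2 (by simpa using ht), fun g hg => ?_⟩
    simp [htx g hg]
  let _ : Encodable G := Encodable.ofCountable G
  have hfin (k : ℕ) : {g : G | Encodable.encode g < k}.Finite :=
    (Set.finite_Iio k).preimage Encodable.encode_injective.injOn
  let E (k : ℕ) : Finset G := (hfin k).toFinset
  have hE {k : ℕ} {g : G} : g ∈ E k ↔ Encodable.encode g < k := by simp [E]
  choose m hm using fun k => hstab (E k)
  let M (k : ℕ) : ℕ := ∑ j ∈ Finset.range (k + 1), m j + k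
  have hmM (k : ℕ) : m k ≤ M k :=
    (Finset.single_le_sum (f := m) (fun _ _ => Nat.zero_le _)
      (Finset.self_mem_range_succ k)).trans (Nat.le_add_right _ _)
  have hMsucc (k : ℕ) : M k ≤ M (k + 1) := by
    simp only [M, Finset.sum_range_succ _ (k + 1)]
    omega
  have hstep (k : ℕ) (p : C (M k)) : ∃ q : C (M (k + 1)), ∀ g ∈ E k, q.1 g = p.1 g := by
    obtain ⟨y, hy, hyp⟩ :=
      hm k (M (k + 1)) ((hmM k).trans (hMsucc k)) p.1 (hC (hmM k) p.2)
    exact ⟨⟨y, hy⟩, hyp⟩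
  choose next hnext using hstep
  let p (k : ℕ) : C (M k) := Nat.rec ⟨(hne _).some, (hne _).some_mem⟩ next k
  have hp (k : ℕ) : ∀ g ∈ E k, (p (k + 1)).1 g = (p k).1 g := hnext k (p k)
  have hp' (k l : ℕ) (hkl : k ≤ l) : ∀ g ∈ E k, (p l).1 g = (p k).1 g := by
    induction l, hkl using Nat.le_induction with
    | base => simp
    | succ l hkl ih =>
      intro g hg
      rw [hp l g (hE.2 ((hE.1 hg).trans_le hkl)), ih g hg]
  refine ⟨fun g => (p (Encodable.encode g + 1)).1 g, Set.mem_iInter.2 fun n => hcl n _ fun F => ?_⟩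
  let l := n + F.sup fun g => Encodable.encode g + 1
  refine ⟨(p l).1, hC ?_ (p l).2, fun g hg => hp' _ _ ?_ g (hE.2 (Nat.lt_succ_self _))⟩
  · simp only [M, l]
    omega
  · exact (Finset.le_sup (f := fun g => Encodable.encode g + 1) hg).trans (Nat.le_add_left _ _)

lemma exists_forall_mem_of_antitone [Countable G] {S : ℕ → Submodule R (G → B)} (hS : Antitone S)
    (hcl : ∀ n, PatternClosed (S n : Set (G → B))) {E : Type*} (φ : E → G) {A : ℕ → Set E}
    (hA : Monotone A) (y : E → B) (hne : ∀ n, ∃ x ∈ S n, ∀ e ∈ A n, x (φ e) = y e) :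
    ∃ x, ∀ n, x ∈ S n ∧ ∀ e ∈ A n, x (φ e) = y e := by
  classical
  let C (n : ℕ) : Set (G → B) := {x | x ∈ S n ∧ ∀ e ∈ A n, x (φ e) = y e}
  let T (n : ℕ) : Submodule R (G → B) := S n ⊓ ⨅ e ∈ A n, LinearMap.ker (LinearMap.proj (φ e))
  have hC : Antitone C := fun a b hab x hx => ⟨hS hab hx.1, fun e he => hx.2 e (hA hab he)⟩
  have hCcl (n : ℕ) : PatternClosed (C n) := by
    intro x hx
    refine ⟨hcl n x fun F => ?_, fun e he => ?_⟩
    · obtain ⟨z, hz, hzx⟩ := hx F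
      exact ⟨z, hz.1, hzx⟩
    · obtain ⟨z, hz, hzx⟩ := hx {φ e}
      rw [← hzx (φ e) (by simp), hz.2 e he]
  have hT (n : ℕ) (c) (hc : c ∈ C n) (x) : x ∈ C n ↔ x - c ∈ T n := by
    have h : x - c ∈ S n ↔ x ∈ S n := (S n).sub_mem_iff_left hc.1
    simp only [C, T, Set.mem_ofPred_eq, Submodule.mem_inf, h, Submodule.mem_iInf, LinearMap.mem_ker,
      LinearMap.proj_apply, Pi.sub_apply, sub_eq_zero]
    refine and_congr_right fun _ => forall₂_congr fun e he => ?_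
    rw [hc.2 e he]
  obtain ⟨x, hx⟩ := nonempty_iInter_of_cosets hC hCcl hne hT
  exact ⟨x, Set.mem_iInter.1 hx⟩

/-- Images of closed submodules under reindexing are closed. -/
lemma PatternClosed.map_funLeft [Countable G] {S : Submodule R (G → B)}
    (hS : PatternClosed (S : Set (G → B))) {E : Type*} [Countable E] (φ : E → G) :
    PatternClosed (S.map (LinearMap.funLeft R B φ) : Set (E → B)) := by
  intro y hy
  let _ : Encodable E := Encodable.ofCountable E
  have hfin (k : ℕ) : {e : E | Encodable.encode e < k}.Finite :=
    (Set.finite_Iio k).preimage Encodable.encode_injective.injOn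
  obtain ⟨x, hx⟩ := exists_forall_mem_of_antitone (S := fun _ => S) antitone_const (fun _ => hS) φ
    (A := fun k => {e : E | Encodable.encode e < k}) (fun a b hab e he => lt_of_lt_of_le he hab) y
    (fun n => by
      obtain ⟨_, ⟨z, hz, rfl⟩, hzy⟩ := hy (hfin n).toFinset
      exact ⟨z, hz, fun e he => hzy e (by simpa using he)⟩)
  exact ⟨x, (hx 0).1, funext fun e => (hx (Encodable.encode e + 1)).2 e (Nat.lt_succ_self _)⟩

end Artinian

lemma IsRMarkovType.exists_window {R : Type u} [Ring R] {H : Type v} [Monoid H]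
    (hH : IsRMarkovType.{u, v, w} R H) {B : Type w} [AddCommGroup B] [Module R B] [IsArtinian R B]
    {S : Submodule R (H → B)} (hinv : ∀ g : H, ∀ x ∈ S, shiftMul g x ∈ S)
    (hcl : PatternClosed (S : Set (H → B))) :
    ∃ D : Finset H, ∀ x : H → B, (∀ g, ∃ y ∈ S, ∀ d ∈ D, y d = x (d * g)) → x ∈ S := by
  let _ : TopologicalSpace B := ⊥
  have _ : DiscreteTopology B := ⟨rfl⟩
  obtain ⟨D, P, hP⟩ := hH B S hinv ((isClosed_iff_patternClosed _).2 hcl)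
  refine ⟨D, fun x hx => ?_⟩
  rw [← SetLike.mem_coe, hP]
  intro g
  obtain ⟨y, hy, hyx⟩ := hx g
  rw [← SetLike.mem_coe, hP] at hy
  convert hy 1 using 2 with d
  simp [shiftMul, hyx d.1 d.2]

lemma IsRMarkovType.antitone_stabilizes {R : Type u} [Ring R] {H : Type v} [Monoid H] [Countable H]
    (hH : IsRMarkovType.{u, v, w} R H) {B : Type w} [AddCommGroup B] [Module R B] [IsArtinian R B]
    {K : ℕ → Submodule R (H → B)} (hK : Antitone K)
    (hinv : ∀ n, ∀ g : H, ∀ x ∈ K n, shiftMul g x ∈ K n)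
    (hcl : ∀ n, PatternClosed (K n : Set (H → B))) : ∃ N, ∀ n, K N ≤ K n := by
  obtain ⟨D, hD⟩ := hH.exists_window (S := ⨅ n, K n)
    (fun g x hx => by
      rw [Submodule.mem_iInf] at hx ⊢
      exact fun n => hinv n g x (hx n))
    (fun x hx => (Submodule.mem_iInf _).2 fun n => hcl n x fun F => by
      obtain ⟨y, hy, hyx⟩ := hx F
      exact ⟨y, (Submodule.mem_iInf _).1 hy n, hyx⟩)
  obtain ⟨N, hN⟩ := exists_forall_eqOn_of_antitone hK D
  refine ⟨N, fun n x hx => (Submodule.mem_iInf _).1 (hD x fun g => ?_) n⟩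
  obtain ⟨y, hy⟩ := exists_forall_mem_of_antitone (S := fun n => K (N + n))
    (fun a b hab => hK (Nat.add_le_add_left hab N)) (fun n => hcl _) id
    (A := fun _ => (D : Set H)) monotone_const (shiftMul g x)
    (fun n => hN (N + n) (Nat.le_add_right _ _) _ (hinv N g x hx))
  exact ⟨y, (Submodule.mem_iInf _).2 fun n => hK (Nat.le_add_left n N) (hy n).1, (hy 0).2⟩

open Multiplicative

theorem statement11 {R : Type u} [Ring R] {H : Type v} [Monoid H] [Countable H]
    (hH : IsRMarkovType.{u, v, w} R H) :
    IsRMarkovType.{u, v, w} R (H × Multiplicative ℕ) := by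
  classical
  intro B _ _ _ _ _ S hinv hclosed
  have hcl := (isClosed_iff_patternClosed _).1 hclosed
  have : Countable (Multiplicative ℕ) := inferInstanceAs (Countable ℕ)
  -- configurations in `S` whose rows of index less than `n` vanish
  let Z (n : ℕ) : Submodule R (H × Multiplicative ℕ → B) :=
    S ⊓ ⨅ (i : ℕ) (_ : i < n) (h : H), LinearMap.ker (LinearMap.proj (h, ofAdd i))
  have hZ {n : ℕ} {x} : x ∈ Z n ↔ x ∈ S ∧ ∀ i < n, ∀ h, x (h, ofAdd i) = 0 := by
    simp [Z, Submodule.mem_iInf]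
  have hZcl (n : ℕ) : PatternClosed (Z n : Set (H × Multiplicative ℕ → B)) := by
    intro x hx
    refine hZ.2 ⟨hcl x fun F => ?_, fun i hi h => ?_⟩
    · obtain ⟨y, hy, hyx⟩ := hx F
      exact ⟨y, (hZ.1 hy).1, hyx⟩
    · obtain ⟨y, hy, hyx⟩ := hx {(h, ofAdd i)}
      rw [← hyx _ (Finset.mem_singleton_self _), (hZ.1 hy).2 i hi h]
  let K (n : ℕ) : Submodule R (H → B) :=
    (Z n).map (LinearMap.funLeft R B fun h => (h, ofAdd n))
  have hKanti : Antitone K := antitone_nat_of_succ_le fun n => by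
    rintro _ ⟨x, hx, rfl⟩
    obtain ⟨hxS, hx0⟩ := hZ.1 hx
    refine ⟨shiftMul (1, ofAdd 1) x, hZ.2 ⟨hinv _ _ hxS, fun i hi h => ?_⟩, ?_⟩
    · simpa [shiftMul, ← ofAdd_add] using hx0 (i + 1) (by omega) h
    · ext h
      simp [shiftMul, LinearMap.funLeft_apply, ← ofAdd_add]
  have hKinv (n : ℕ) (g : H) (x) (hx : x ∈ K n) : shiftMul g x ∈ K n := by
    obtain ⟨x, hx, rfl⟩ := hx
    obtain ⟨hxS, hx0⟩ := hZ.1 hx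
    refine ⟨shiftMul (g, 1) x, hZ.2 ⟨hinv _ _ hxS, fun i hi h => ?_⟩, ?_⟩
    · simpa [shiftMul] using hx0 i hi (h * g)
    · ext h
      simp [shiftMul, LinearMap.funLeft_apply]
  obtain ⟨N, hN⟩ := hH.antitone_stabilizes hKanti hKinv fun n => (hZcl n).map_funLeft _
  -- the restriction of `S` to the first `N + 1` rows, over the alphabet `B ^ (N + 1)`
  let ρ : (H × Multiplicative ℕ → B) →ₗ[R] (H → Fin (N + 1) → B) :=
    { toFun := fun x h i => x (h, ofAdd (i : ℕ))
      map_add' := fun _ _ => rfl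
      map_smul' := fun _ _ => rfl }
  have hWcl : PatternClosed (S.map ρ : Set (H → Fin (N + 1) → B)) := by
    intro y hy
    obtain ⟨x, hx, hxy⟩ := hcl.map_funLeft
      (fun e : H × Fin (N + 1) => (e.1, ofAdd (e.2 : ℕ))) (fun e => y e.1 e.2) fun F => by
        obtain ⟨_, ⟨z, hz, rfl⟩, hzy⟩ := hy (F.image Prod.fst)
        exact ⟨_, ⟨z, hz, rfl⟩, fun e he =>
          congrFun (hzy e.1 (Finset.mem_image_of_mem _ he)) e.2⟩
    exact ⟨x, hx, funext fun h => funext fun i => congrFun hxy (h, i)⟩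
  obtain ⟨D, hD⟩ := hH.exists_window (S := S.map ρ)
    (by
      rintro g _ ⟨x, hx, rfl⟩
      refine ⟨shiftMul (g, 1) x, hinv _ _ hx, ?_⟩
      ext h i
      simp [shiftMul, ρ]) hWcl
  let E : Finset (H × Multiplicative ℕ) := D ×ˢ (Finset.range (N + 1)).image ofAdd
  refine ⟨E, {q | ∃ y ∈ S, ∀ d, y d.1 = q d}, Set.Subset.antisymm
    (fun x hx g => ⟨shiftMul g x, hinv g x hx, fun _ => rfl⟩) fun x hx => ?_⟩
  have hwin (n : ℕ) : ∃ z ∈ S, ∀ h, ∀ i ≤ N, z (h, ofAdd i) = x (h, ofAdd (i + n)) := by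
    obtain ⟨z, hz, hzx⟩ := hD (fun h i => x (h, ofAdd ((i : ℕ) + n))) fun g => by
      obtain ⟨y, hy, hyx⟩ := hx (g, ofAdd n)
      refine ⟨ρ y, ⟨y, hy, rfl⟩, fun d hd => funext fun i => ?_⟩
      have hmem : (d, ofAdd (i : ℕ)) ∈ (E : Set (H × Multiplicative ℕ)) := by
        simp only [E, Finset.coe_product, Set.mem_prod, Finset.mem_coe]
        exact ⟨hd, Finset.mem_image_of_mem _ (Finset.mem_range.2 i.2)⟩
      simpa [shiftMul, ρ, ofAdd_add] using hyx ⟨_, hmem⟩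
    exact ⟨z, hz, fun h i hi => congrFun (congrFun hzx h) ⟨i, Nat.lt_succ_of_le hi⟩⟩
  have hrows (n : ℕ) : ∃ y ∈ S, ∀ h, ∀ i < N + n, y (h, ofAdd i) = x (h, ofAdd i) := by
    induction n with
    | zero =>
      obtain ⟨z, hz, hzx⟩ := hwin 0
      exact ⟨z, hz, fun h i hi => hzx h i (by omega)⟩
    | succ n ih =>
      obtain ⟨y, hy, hyx⟩ := ih
      obtain ⟨z, hz, hzx⟩ := hwin n
      have hmem : (fun h => y (h, ofAdd (N + n)) - x (h, ofAdd (N + n))) ∈ K N := by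
        refine ⟨shiftMul (1, ofAdd n) y - z,
          hZ.2 ⟨S.sub_mem (hinv _ _ hy) hz, fun i hi h => ?_⟩, ?_⟩
        · simp [shiftMul, ← ofAdd_add, hzx h i hi.le, hyx h (i + n) (by omega)]
        · ext h
          simp [shiftMul, ← ofAdd_add, LinearMap.funLeft_apply, hzx h N le_rfl]
      obtain ⟨w, hw, hwx⟩ := hN (N + n) hmem
      obtain ⟨hwS, hw0⟩ := hZ.1 hw
      refine ⟨y - w, S.sub_mem hy hwS, fun h i hi => ?_⟩
      rcases (show i ≤ N + n by omega).lt_or_eq with hlt | rfl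
      · simp [hw0 i hlt h, hyx h i hlt]
      · have := congrFun hwx h
        simp only [LinearMap.funLeft_apply] at this
        rw [Pi.sub_apply, this, sub_sub_cancel]
  refine hcl x fun F => ?_
  obtain ⟨y, hy, hyx⟩ := hrows (F.sup (fun e => toAdd e.2) + 1)
  refine ⟨y, hy, fun e he => hyx e.1 (toAdd e.2) ?_⟩
  have := Finset.le_sup (f := fun e : H × Multiplicative ℕ => toAdd e.2) he
  omega
end

section
/- Fix a ring R. Let H be a countable monoid of R-Markov type, i.e., for every Artinian R-module B, every subshift of B^H that is closed in the prodiscrete topology and is an R-submodule of the product module B^H is a subshift of finite type of B^H. Let F be a finite monoid. Then the countable monoid H × F is also of R-Markov type: for every Artinian R-module B, every subshift of B^{H×F} that is closed in the prodiscrete topology and is an R-submodule of B^{H×F} is a subshift of finite type of B^{H×F}. -/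
universe u v w

/-- Configurations over `H` with values in `ι → B` regarded as configurations over `H × F`,
along an identification `F ≃ ι`. -/
def uncurryLinearMap (R : Type*) [Ring R] (H : Type*) {F ι : Type*} (e : F ≃ ι)
    (B : Type*) [AddCommGroup B] [Module R B] : (H → ι → B) →ₗ[R] (H × F → B) where
  toFun y p := y p.1 (e p.2)
  map_add' _ _ := rfl
  map_smul' _ _ := rfl

theorem continuous_uncurryLinearMap (R : Type*) [Ring R] (H : Type*) {F ι : Type*} (e : F ≃ ι)
    (B : Type*) [AddCommGroup B] [Module R B] [TopologicalSpace B] :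
    Continuous (uncurryLinearMap R H e B) := by
  change Continuous fun (y : H → ι → B) (p : H × F) => y p.1 (e p.2)
  fun_prop

/-- If the currying of every `F`-shift of `x` obeys the local rule `(D, P)`, then `x` obeys the
corresponding local rule over `D × F`, and conversely. -/
theorem mem_sigmaSet_prod_iff {H F ι B : Type*} [Monoid H] [Monoid F] [Fintype F] (e : F ≃ ι)
    (D : Finset H) (P : Set (↥(D : Set H) → ι → B)) (x : H × F → B) :
    x ∈ SigmaSet ((D ×ˢ Finset.univ : Finset (H × F)) : Set (H × F))
        {p | (fun (d : ↥(D : Set H)) i => p ⟨(d, e.symm i), by simp⟩) ∈ P} ↔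
      ∀ k : F, (fun h i => shiftMul ((1 : H), k) x (h, e.symm i)) ∈ SigmaSet (D : Set H) P := by
  simp only [SigmaSet, shiftMul, Set.mem_ofPred_eq, Prod.forall, Prod.mk_mul_mk, mul_one]
  exact forall_comm

theorem statement12 {R : Type u} [Ring R] {H : Type v} [Monoid H] [Countable H]
    (hH : IsRMarkovType.{u, v, w} R H)
    {F : Type v} [Monoid F] [Finite F] :
    IsRMarkovType.{u, v, w} R (H × F) := by
  intro B _ _ _ _ _ Sgm hinv hcl
  obtain ⟨n, ⟨e⟩⟩ := Finite.exists_equiv_fin F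
  have := Fintype.ofFinite F
  let φ := uncurryLinearMap R H e B
  have hcurry (x : H × F → B) : φ (fun h i => x (h, e.symm i)) = x := by
    ext p
    simp [φ, uncurryLinearMap]
  have hinv' : ∀ g : H, ∀ y ∈ Sgm.comap φ, shiftMul g y ∈ Sgm.comap φ := by
    intro g y hy
    have h : φ (shiftMul g y) = shiftMul (g, (1 : F)) (φ y) := by
      ext p
      simp [φ, uncurryLinearMap, shiftMul]
    rw [Submodule.mem_comap, h]
    exact hinv _ _ hy
  obtain ⟨D, P, hDP⟩ := hH (Fin n → B) (Sgm.comap φ) hinv'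
    (hcl.preimage (continuous_uncurryLinearMap R H e B))
  refine ⟨D ×ˢ Finset.univ, _, Set.ext fun x => Iff.trans ?_ (mem_sigmaSet_prod_iff e D P x).symm⟩
  simp only [← hDP, SetLike.mem_coe, Submodule.mem_comap, hcurry]
  refine ⟨fun hx k => hinv _ x hx, fun hx => ?_⟩
  have h : shiftMul ((1 : H), (1 : F)) x = x := by
    ext p
    exact congrArg x (mul_one p)
  exact h ▸ hx 1
end

section
/- Fix a ring R. Let G be a countable monoid of R-Markov type, i.e., for every Artinian R-module B, every subshift of B^G that is closed in the prodiscrete topology and is an R-submodule of the product module B^G is a subshift of finite type of B^G. Let V be an Artinian R-module. Then every descending sequence (Σ_n)_{n≥0} (with Σ_{n+1} ⊆ Σ_n for all n) of subshifts of V^G, each closed in the prodiscrete topology and an R-submodule of V^G, eventually stabilizes: there exists N ∈ ℕ such that Σ_n = Σ_N for all n ≥ N. -/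
universe u v w

/-- For a descending sequence of submodules of `G → V` with `V` Artinian, the restrictions to a
finite set stabilize. -/
theorem exists_stable_restriction {R : Type*} [Ring R] {G V : Type*} [AddCommGroup V] [Module R V]
    [IsArtinian R V] {S : ℕ → Submodule R (G → V)} (hS : Antitone S) (E : Finset G) :
    ∃ n, ∀ x ∈ S n, ∀ m, ∃ y ∈ S m, ∀ e ∈ E, y e = x e := by
  let r : (G → V) →ₗ[R] (E → V) := LinearMap.funLeft R V Subtype.val
  obtain ⟨n, hn⟩ := IsArtinian.monotone_stabilizes
    (⟨fun n => OrderDual.toDual ((S n).map r), fun _ _ h => Submodule.map_mono (hS h)⟩ :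
      ℕ →o (Submodule R (E → V))ᵒᵈ)
  refine ⟨n, fun x hx m => ?_⟩
  have key : (S n).map r = (S (max n m)).map r := hn _ (le_max_left n m)
  have hrx : r x ∈ (S (max n m)).map r := key ▸ Submodule.mem_map_of_mem hx
  obtain ⟨y, hy, hyx⟩ := Submodule.mem_map.1 hrx
  exact ⟨y, hS (le_max_right n m) hy, fun e he => congrFun hyx ⟨e, he⟩⟩

/-- For a descending sequence of closed submodules of `G → V` with `G` countable and `V` Artinian
and discrete, every pattern over a finite set `D` which occurs sufficiently far in the sequence
occurs in the intersection. -/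
theorem exists_mem_iInf_eqOn {R : Type*} [Ring R] {G V : Type*} [Countable G] [Nonempty G]
    [AddCommGroup V] [Module R V] [IsArtinian R V] [TopologicalSpace V]
    {S : ℕ → Submodule R (G → V)} (hS : Antitone S)
    (hclosed : ∀ n, IsClosed (S n : Set (G → V))) (D : Finset G) :
    ∃ N, ∀ x ∈ S N, ∃ y ∈ ⨅ n, S n, ∀ d ∈ D, y d = x d := by
  classical
  obtain ⟨f, hf⟩ := exists_surjective_nat G
  let E : ℕ → Finset G := fun k => D ∪ (Finset.range k).image f
  have hE : Monotone E := fun a b hab => by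
    dsimp only [E]
    gcongr
  have hcover : ∀ g, ∃ k, g ∈ E k := fun g => by
    obtain ⟨k, rfl⟩ := hf g
    exact ⟨k + 1, Finset.mem_union_right _
      (Finset.mem_image_of_mem _ (Finset.self_mem_range_succ k))⟩
  choose ν hν using fun k => exists_stable_restriction hS (E k)
  refine ⟨ν 0, fun x hx => ?_⟩
  choose next hnext_mem hnext_eq using
    fun k (y : S (ν k)) => hν k y y.2 (ν (k + 1))
  let z : ∀ k, S (ν k) := fun k =>
    Nat.rec ⟨x, hx⟩ (fun k y => ⟨next k y, hnext_mem k y⟩) k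
  have hz_succ : ∀ k, ∀ g ∈ E k, (z (k + 1)).1 g = (z k).1 g :=
    fun k => hnext_eq k (z k)
  have hz : ∀ {j k}, j ≤ k → ∀ g ∈ E j, (z k).1 g = (z j).1 g := by
    intro j k hjk g hg
    induction k, hjk using Nat.le_induction with
    | base => rfl
    | succ k hjk ih => rw [hz_succ k g (hE hjk hg), ih]
  choose κ hκ using hcover
  let y : G → V := fun g => (z (κ g)).1 g
  have hy : ∀ k, ∀ g ∈ E k, y g = (z k).1 g := fun k g hg => by
    rcases le_total k (κ g) with h | h
    · exact hz h g hg
    · exact (hz h g (hκ g)).symm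
  refine ⟨y, (Submodule.mem_iInf _).2 fun n => ?_, fun d hd =>
    hy 0 d (Finset.mem_union_left _ hd)⟩
  choose w hw_mem hw_eq using fun k => hν k (z k).1 (z k).2 n
  refine (hclosed n).mem_of_tendsto (f := w) (b := Filter.atTop) ?_ (.of_forall hw_mem)
  refine tendsto_pi_nhds.2 fun g => tendsto_const_nhds.congr' ?_
  filter_upwards [Filter.eventually_ge_atTop (κ g)] with k hk
  have hg := hE hk (hκ g)
  rw [hw_eq k g hg, hy k g hg]

theorem statement13 {R : Type u} [Ring R] {G : Type v} [Monoid G] [Countable G]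
    (hG : IsRMarkovType.{u, v, w} R G)
    (V : Type w) [AddCommGroup V] [Module R V] [IsArtinian R V]
    [TopologicalSpace V] [DiscreteTopology V]
    (Sgm : ℕ → Submodule R (G → V))
    (hdesc : ∀ n, Sgm (n + 1) ≤ Sgm n)
    (hshift : ∀ n, ∀ g : G, ∀ x ∈ Sgm n, shiftMul g x ∈ Sgm n)
    (hclosed : ∀ n, IsClosed (Sgm n : Set (G → V))) :
    ∃ N, ∀ n ≥ N, Sgm n = Sgm N := by
  have hanti : Antitone Sgm := antitone_nat_of_succ_le hdesc
  obtain ⟨D, P, hP⟩ := hG V (⨅ n, Sgm n)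
    (fun g x hx => (Submodule.mem_iInf _).2 fun n =>
      hshift n g x ((Submodule.mem_iInf _).1 hx n))
    (by
      rw [Submodule.coe_iInf]
      exact isClosed_iInter hclosed)
  obtain ⟨N, hN⟩ := exists_mem_iInf_eqOn hanti hclosed D
  refine ⟨N, fun n hn => le_antisymm (hanti hn) fun x hx => ?_⟩
  suffices hx' : x ∈ ((⨅ n, Sgm n : Submodule R (G → V)) : Set (G → V)) from
    (Submodule.mem_iInf _).1 hx' n
  rw [hP]
  intro g
  obtain ⟨y, hy, hyx⟩ := hN _ (hshift N g x hx)
  have hyP : y ∈ SigmaSet (D : Set G) P := hP ▸ hy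
  convert hyP 1 using 2 with d
  simpa [shiftMul] using (hyx d d.2).symm
end

section
/- Let G be a countable monoid, R a ring, and A an Artinian R-module. Let Σ ⊆ A^G be a subshift that is closed in the prodiscrete topology and is an R-submodule of A^G. Let τ_1, …, τ_r : Σ → Σ be pairwise commuting maps, each of which is the restriction to Σ of a cellular automaton A^G → A^G that maps Σ into Σ and admits a memory set with R-linear local defining map. For α = (a_1, …, a_r) ∈ ℕ^r write τ_α := τ_1^{a_1} ∘ ⋯ ∘ τ_r^{a_r}. Let E ⊆ G be a finite subset, and define Ψ_E : Σ → (Σ_E)^{ℕ^r} by Ψ_E(x)(α) := (τ_α(x))|_E, and let Λ := Ψ_E(Σ) be the associated column factorization. Then Λ is a subshift of (Σ_E)^{ℕ^r} (invariant under the shift action of the additive monoid ℕ^r), Λ is closed in the prodiscrete topology of (Σ_E)^{ℕ^r}, and for every finite subset F ⊆ ℕ^r the restriction Λ_F := {y|_F : y ∈ Λ} is an R-submodule of (A^E)^F. -/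
/-- `τ_α = τ 0 ^[α 0] ∘ τ 1 ^[α 1] ∘ ⋯ ∘ τ (r-1) ^[α (r-1)]` as a self-map of `X`. -/
def tauPow {X : Type*} {r : ℕ} (τ : Fin r → X → X) (α : Fin r → ℕ) : X → X :=
  ((List.ofFn fun i => (τ i)^[α i] : List (Function.End X)).prod : Function.End X)

/-- In a monoid, the product of a finite list of pointwise products splits when the factors
commute. -/
theorem prod_ofFn_mul_of_commute {M : Type*} [Monoid M] {n : ℕ} (f g : Fin n → M)
    (h : ∀ i j, Commute (f i) (g j)) :
    (List.ofFn fun i => f i * g i).prod = (List.ofFn f).prod * (List.ofFn g).prod := by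
  induction n with
  | zero => simp
  | succ n ih =>
    simp only [List.ofFn_succ, List.prod_cons]
    rw [ih (fun i => f i.succ) (fun i => g i.succ) fun i j => h _ _]
    have hc : Commute (List.ofFn fun i : Fin n => f i.succ).prod (g 0) := by
      refine Commute.list_prod_left _ _ fun x hx => ?_
      obtain ⟨i, rfl⟩ := (List.mem_ofFn' _ _).1 hx
      exact h _ _
    rw [mul_assoc, mul_assoc, ← mul_assoc (g 0), ← hc.eq, mul_assoc]

theorem tauPow_add {X : Type*} {r : ℕ} (τ : Fin r → X → X)
    (hcomm : ∀ i j x, τ i (τ j x) = τ j (τ i x)) (α β : Fin r → ℕ) (x : X) :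
    tauPow τ (α + β) x = tauPow τ α (tauPow τ β x) := by
  let T : Fin r → Function.End X := τ
  have hT : ∀ i j, Commute (T i) (T j) := fun i j => funext fun x => hcomm i j x
  have hit : ∀ i n, ((τ i)^[n] : Function.End X) = T i ^ n := fun i n => by
    induction n with
    | zero => rfl
    | succ n ih => rw [Function.iterate_succ, pow_succ, ← ih]; rfl
  have key := prod_ofFn_mul_of_commute (fun i => T i ^ α i) (fun i => T i ^ β i)
    fun i j => (hT i j).pow_pow _ _
  simp only [← pow_add] at key
  have hp : ∀ γ : Fin r → ℕ,
      (tauPow τ γ : Function.End X) = (List.ofFn fun i => T i ^ γ i).prod := fun γ => by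
    unfold tauPow
    simp only [hit]
    rfl
  exact congrFun ((hp (α + β)).trans (key.trans (congrArg₂ (· * ·) (hp α).symm (hp β).symm))) x

theorem tauPow_induction {X : Type*} {r : ℕ} (τ : Fin r → X → X) (p : (X → X) → Prop)
    (hid : p id) (hcomp : ∀ f g, p f → p g → p (f ∘ g)) (hτ : ∀ i, p (τ i)) (α : Fin r → ℕ) :
    p (tauPow τ α) := by
  refine List.prod_induction (M := Function.End X) p hcomp hid fun f hf => ?_
  obtain ⟨i, rfl⟩ := (List.mem_ofFn' _ _).1 hf
  change p (τ i)^[α i]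
  induction α i with
  | zero => exact hid
  | succ n ih => rw [Function.iterate_succ]; exact hcomp _ _ ih (hτ i)

/-- A family of affine subspaces in which every finite intersection is nonempty. -/
def AffineFIP {R V : Type*} [Ring R] [AddCommGroup V] [Module R V]
    (S : Set (AffineSubspace R V)) : Prop :=
  ∀ t : Finset (AffineSubspace R V), ↑t ⊆ S → (⋂ C ∈ t, (C : Set V)).Nonempty

section AffineFIP

variable {R V : Type*} [Ring R] [AddCommGroup V] [Module R V]

theorem AffineFIP.exists_maximal {S : Set (AffineSubspace R V)} (hS : AffineFIP S) :
    ∃ T, S ⊆ T ∧ Maximal AffineFIP T := by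
  refine zorn_subset_nonempty {T | AffineFIP T} (fun c hc hchain hne => ?_) S hS
  refine ⟨⋃₀ c, fun t ht => ?_, fun s hs => Set.subset_sUnion_of_mem hs⟩
  obtain ⟨s, hs, hts⟩ := DirectedOn.exists_mem_subset_of_finset_subset_biUnion hne
    (f := id) hchain.directedOn (by rwa [Set.sUnion_eq_biUnion] at ht)
  exact hc hs t hts

theorem AffineFIP.mem_of_maximal {T : Set (AffineSubspace R V)} (hT : Maximal AffineFIP T)
    {D : AffineSubspace R V}
    (hD : ∀ t : Finset (AffineSubspace R V), ↑t ⊆ T →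
      ((D : Set V) ∩ ⋂ C ∈ t, (C : Set V)).Nonempty) : D ∈ T := by
  classical
  refine hT.2 (y := insert D T) (fun t ht => ?_) (Set.subset_insert _ _) (Set.mem_insert _ _)
  obtain ⟨x, hxD, hx⟩ := hD (t.erase D) fun C hC => by
    have hC' := Finset.mem_erase.1 (Finset.mem_coe.1 hC)
    exact (ht hC'.2).resolve_left hC'.1
  refine ⟨x, Set.mem_iInter₂.2 fun C hC => ?_⟩
  by_cases h : C = D
  · exact h ▸ hxD
  · exact Set.mem_iInter₂.1 hx C (Finset.mem_erase.2 ⟨h, hC⟩)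

theorem AffineFIP.finset_inf_mem_of_maximal {T : Set (AffineSubspace R V)}
    (hT : Maximal AffineFIP T) (t : Finset (AffineSubspace R V)) (ht : ↑t ⊆ T) :
    t.inf id ∈ T := by
  classical
  have hcoe : ((t.inf id : AffineSubspace R V) : Set V) = ⋂ C ∈ t, (C : Set V) := by
    clear ht
    induction t using Finset.induction_on with
    | empty => simp
    | insert a s _ ih =>
      ext x
      have ihx := Set.ext_iff.1 ih x
      simp only [SetLike.mem_coe, Set.mem_iInter] at ihx
      simp [Finset.inf_insert, AffineSubspace.mem_inf_iff, ihx]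
  refine AffineFIP.mem_of_maximal hT fun s hs => ?_
  obtain ⟨x, hx⟩ := hT.1 (t ∪ s) (by simpa using ⟨ht, hs⟩)
  rw [Set.mem_iInter₂] at hx
  rw [hcoe]
  exact ⟨x, Set.mem_iInter₂.2 fun C hC => hx C (Finset.mem_union_left _ hC),
    Set.mem_iInter₂.2 fun C hC => hx C (Finset.mem_union_right _ hC)⟩

/-- The affine subspace on which a linear map takes a prescribed value. -/
def fiberSubspace {A : Type*} [AddCommGroup A] [Module R A] (f : V →ₗ[R] A) (a : A) :
    AffineSubspace R V where
  carrier := {x | f x = a}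
  smul_vsub_vadd_mem' c p q s hp hq hs := by
    simp only [Set.mem_ofPred_eq] at *
    simp [hp, hq, hs]

theorem mem_fiberSubspace {A : Type*} [AddCommGroup A] [Module R A] {f : V →ₗ[R] A} {a : A}
    {x : V} : x ∈ fiberSubspace f a ↔ f x = a := Iff.rfl

/-- A maximal family with the finite intersection property contains a fibre of every linear map
to an Artinian module. -/
theorem AffineFIP.exists_fiberSubspace_mem {T : Set (AffineSubspace R V)}
    (hT : Maximal AffineFIP T) {A : Type*} [AddCommGroup A] [Module R A] [IsArtinian R A]
    (f : V →ₗ[R] A) : ∃ a, fiberSubspace f a ∈ T := by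
  classical
  have htop : (⊤ : AffineSubspace R V) ∈ T := by
    simpa using AffineFIP.finset_inf_mem_of_maximal hT ∅ (by simp)
  have hne : ∀ C ∈ T, (C : Set V).Nonempty := fun C hC => by
    simpa using hT.1 {C} (by simpa using hC)
  obtain ⟨_, ⟨C₀, hC₀, rfl⟩, hmin⟩ := IsArtinian.set_has_minimal
    ((fun C : AffineSubspace R V => C.direction.map f) '' T) ⟨_, _, htop, rfl⟩
  obtain ⟨x₀, hx₀⟩ := hne C₀ hC₀
  refine ⟨f x₀, AffineFIP.mem_of_maximal hT fun t ht => ?_⟩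
  have ht' : (↑(insert C₀ t) : Set (AffineSubspace R V)) ⊆ T := by
    rw [Finset.coe_insert]
    exact Set.insert_subset hC₀ ht
  have hD := AffineFIP.finset_inf_mem_of_maximal hT _ ht'
  set D := (insert C₀ t).inf id with hDdef
  have hDle : ∀ C ∈ insert C₀ t, D ≤ C := fun C hC => Finset.inf_le (f := id) hC
  have hDC₀ : D ≤ C₀ := hDle C₀ (Finset.mem_insert_self _ _)
  have hdir : D.direction.map f = C₀.direction.map f := by
    have hle : D.direction.map f ≤ C₀.direction.map f :=
      Submodule.map_mono (AffineSubspace.direction_le hDC₀)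
    exact hle.eq_of_not_lt (hmin _ ⟨D, hD, rfl⟩)
  obtain ⟨z, hz⟩ := hne D hD
  have hmem : f (x₀ - z) ∈ D.direction.map f := by
    rw [hdir]
    exact Submodule.mem_map_of_mem (AffineSubspace.vsub_mem_direction hx₀ (hDC₀ hz))
  obtain ⟨v, hv, hfv⟩ := Submodule.mem_map.1 hmem
  have hvz : v +ᵥ z ∈ D := AffineSubspace.vadd_mem_of_mem_direction hv hz
  refine ⟨v + z, ?_, Set.mem_iInter₂.2 fun C hC => hDle C (Finset.mem_insert_of_mem hC) hvz⟩
  change f (v + z) = f x₀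
  rw [map_add, hfv, map_sub, sub_add_cancel]

end AffineFIP

/-- Closed submodules of a power of a discrete Artinian module are linearly compact. -/
theorem AffineFIP.nonempty_iInter {I R A : Type*} [Ring R] [AddCommGroup A] [Module R A]
    [IsArtinian R A] [TopologicalSpace A] [DiscreteTopology A] {N : Submodule R (I → A)}
    (hN : IsClosed (N : Set (I → A))) {S : Set (AffineSubspace R N)} (hS : AffineFIP S)
    (hSc : ∀ C ∈ S, IsClosed (C : Set N)) : (⋂ C ∈ S, (C : Set N)).Nonempty := by
  classical
  obtain ⟨T, hST, hT⟩ := hS.exists_maximal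
  choose a ha using fun i => AffineFIP.exists_fiberSubspace_mem hT
    ((LinearMap.proj i : (I → A) →ₗ[R] A).comp N.subtype)
  have hcl : ∀ C ∈ T, a ∈ closure (((↑) : N → I → A) '' (C : Set N)) := fun C hC => by
    refine mem_closure_iff.2 fun U hU haU => ?_
    obtain ⟨s, u, hu, hsU⟩ := isOpen_pi_iff.1 hU a haU
    obtain ⟨z, hz⟩ := hT.1 (insert C (s.image fun i => fiberSubspace
      ((LinearMap.proj i : (I → A) →ₗ[R] A).comp N.subtype) (a i))) (by
        intro D hD
        rcases Finset.mem_insert.1 (Finset.mem_coe.1 hD) with rfl | hD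
        · exact hC
        · obtain ⟨i, -, rfl⟩ := Finset.mem_image.1 hD
          exact ha i)
    rw [Set.mem_iInter₂] at hz
    refine ⟨z, hsU fun i hi => ?_, z, hz C (Finset.mem_insert_self _ _), rfl⟩
    have hzi : z.1 i = a i :=
      hz _ (Finset.mem_insert_of_mem (Finset.mem_image_of_mem _ (Finset.mem_coe.1 hi)))
    rw [hzi]
    exact (hu i hi).2
  have htop : (⊤ : AffineSubspace R N) ∈ T := by
    simpa using AffineFIP.finset_inf_mem_of_maximal hT ∅ (by simp)
  have haN : a ∈ N := by
    have := hcl ⊤ htop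
    rw [AffineSubspace.top_coe, Set.image_univ, Subtype.range_coe] at this
    rwa [hN.closure_eq] at this
  refine ⟨⟨a, haN⟩, Set.mem_iInter₂.2 fun C hC => ?_⟩
  rw [← (hSc C hC).closure_eq]
  exact closure_subtype.2 (hcl C (hST hC))

/-- A continuous linear image of a closed submodule of a power of a discrete Artinian module
in another such power is closed. -/
theorem isClosed_range_of_isArtinian {I K R A : Type*} [Ring R] [AddCommGroup A] [Module R A]
    [IsArtinian R A] [TopologicalSpace A] [DiscreteTopology A] {N : Submodule R (I → A)}
    (hN : IsClosed (N : Set (I → A))) (f : K → N →ₗ[R] A) (hf : ∀ k, Continuous (f k)) :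
    IsClosed (Set.range fun (x : N) (k : K) => f k x) := by
  classical
  refine isClosed_of_closure_subset fun y hy => ?_
  have hS : AffineFIP (Set.range fun k => fiberSubspace (f k) (y k)) := fun t ht => by
    obtain ⟨s, rfl⟩ : ∃ s : Finset K, s.image (fun k => fiberSubspace (f k) (y k)) = t := by
      obtain ⟨s, -, hs⟩ := Finset.subset_set_image_iff.1 (Set.image_univ ▸ ht)
      exact ⟨s, hs⟩
    obtain ⟨_, hz, x, rfl⟩ := mem_closure_iff.1 hy ((s : Set K).pi fun k => {y k})
      (isOpen_set_pi s.finite_toSet fun k _ => isOpen_discrete _) fun k _ => rfl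
    refine ⟨x, Set.mem_iInter₂.2 fun C hC => ?_⟩
    obtain ⟨k, hk, rfl⟩ := Finset.mem_image.1 hC
    exact hz k hk
  obtain ⟨x, hx⟩ := AffineFIP.nonempty_iInter hN hS (by
    rintro _ ⟨k, rfl⟩
    exact (isClosed_discrete {y k}).preimage (hf k))
  rw [Set.mem_iInter₂] at hx
  exact ⟨x, funext fun k => hx _ ⟨k, rfl⟩⟩


theorem statement14 {G : Type*} [Monoid G] [Countable G]
    {R : Type*} [Ring R] {A : Type*} [AddCommGroup A] [Module R A] [IsArtinian R A]
    [TopologicalSpace A] [DiscreteTopology A]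
    (Sgm : Submodule R (G → A))
    (hshift : ∀ g : G, ∀ x ∈ Sgm, shiftMul g x ∈ Sgm)
    (hclosed : IsClosed (Sgm : Set (G → A)))
    {r : ℕ} (τ : Fin r → ↥Sgm → ↥Sgm)
    (hcomm : ∀ i j x, τ i (τ j x) = τ j (τ i x))
    (hloc : ∀ i, ∃ (M : Finset G) (μ : (↥(M : Set G) → A) →ₗ[R] A),
      ∀ (x : ↥Sgm) (g : G), (τ i x).1 g = μ fun m : ↥(M : Set G) => x.1 (↑m * g))
    (E : Finset G)
    (SE : Set (↥(E : Set G) → A))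
    (hSE : SE = Set.range fun x : ↥Sgm => fun e : ↥(E : Set G) => x.1 ↑e)
    (Λ : Set ((Fin r → ℕ) → ↥(E : Set G) → A))
    (hΛ : Λ = Set.range fun x : ↥Sgm =>
      fun (α : Fin r → ℕ) (e : ↥(E : Set G)) => (tauPow τ α x).1 ↑e) :
    (∀ β : Fin r → ℕ, ∀ y ∈ Λ, (fun α => y (α + β)) ∈ Λ) ∧
    (∀ y ∈ Λ, ∀ α : Fin r → ℕ, y α ∈ SE) ∧
    IsClosed Λ ∧
    (∀ F : Finset (Fin r → ℕ),
      ∃ N : Submodule R (↥(F : Set (Fin r → ℕ)) → ↥(E : Set G) → A),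
        (N : Set (↥(F : Set (Fin r → ℕ)) → ↥(E : Set G) → A)) =
          {q | ∃ y ∈ Λ, ∀ f : ↥(F : Set (Fin r → ℕ)), q f = y ↑f}) := by
  have hlin : ∀ i, ∃ L : Sgm →ₗ[R] Sgm, ⇑L = τ i ∧ Continuous L := fun i => by
    obtain ⟨M, μ, h⟩ := hloc i
    refine ⟨{ toFun := τ i, map_add' := fun x y => ?_, map_smul' := fun c x => ?_ }, rfl, ?_⟩
    · ext g
      change (τ i (x + y)).1 g = (τ i x).1 g + (τ i y).1 g
      rw [h, h, h, ← map_add]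
      rfl
    · ext g
      change (τ i (c • x)).1 g = c • (τ i x).1 g
      rw [h, h, ← map_smul]
      rfl
    · refine Continuous.subtype_mk (continuous_pi fun g => ?_) _
      change Continuous fun x => (τ i x).1 g
      simp only [h]
      refine (continuous_of_discreteTopology (f := μ)).comp (continuous_pi fun m => ?_)
      exact (continuous_apply _).comp continuous_subtype_val
  have hpow : ∀ α, ∃ L : Sgm →ₗ[R] Sgm, ⇑L = tauPow τ α ∧ Continuous L :=
    tauPow_induction τ (fun f => ∃ L : Sgm →ₗ[R] Sgm, ⇑L = f ∧ Continuous L)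
      ⟨LinearMap.id, rfl, continuous_id⟩
      (by rintro _ _ ⟨L, rfl, hL⟩ ⟨L', rfl, hL'⟩; exact ⟨L ∘ₗ L', rfl, hL.comp hL'⟩) hlin
  choose L hL hLc using hpow
  subst hSE hΛ
  refine ⟨?_, ?_, ?_, ?_⟩
  · rintro β _ ⟨x, rfl⟩
    exact ⟨tauPow τ β x, by simp only [tauPow_add τ hcomm]⟩
  · rintro _ ⟨x, rfl⟩ α
    exact ⟨tauPow τ α x, rfl⟩
  · have hcl := isClosed_range_of_isArtinian hclosed
      (fun k : (Fin r → ℕ) × ↥(E : Set G) =>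
        (LinearMap.proj (k.2 : G) : (G → A) →ₗ[R] A) ∘ₗ Sgm.subtype ∘ₗ L k.1)
      (fun k => (continuous_apply (k.2 : G)).comp (continuous_subtype_val.comp (hLc k.1)))
    have hun : Continuous fun (y : (Fin r → ℕ) → ↥(E : Set G) → A)
        (k : (Fin r → ℕ) × ↥(E : Set G)) => y k.1 k.2 := by fun_prop
    convert hcl.preimage hun using 1
    ext y
    constructor
    · rintro ⟨x, rfl⟩
      exact ⟨x, funext fun k => by simp [hL]⟩
    · rintro ⟨x, hx⟩
      refine ⟨x, funext fun α => funext fun e => ?_⟩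
      simpa [hL] using congrFun hx (α, e)
  · intro F
    refine ⟨LinearMap.range (LinearMap.pi fun f : ↥(F : Set (Fin r → ℕ)) =>
      LinearMap.pi fun e : ↥(E : Set G) =>
        (LinearMap.proj (e : G) : (G → A) →ₗ[R] A) ∘ₗ Sgm.subtype ∘ₗ L f), ?_⟩
    ext q
    constructor
    · rintro ⟨x, rfl⟩
      exact ⟨_, ⟨x, rfl⟩, fun f => funext fun e => by simp [hL]⟩
    · rintro ⟨_, ⟨x, rfl⟩, hq⟩
      exact ⟨x, funext fun f => by rw [hq f]; exact funext fun e => by simp [hL]⟩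
end
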